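/- arXiv:2512.09499 — 3 statements merged into one kernel-verified Lean document; each statement's English description precedes it below -/
import Mathlib

section
/- Let p = 2 and suppose μ ∈ P(ℝ^d), ν ∈ P(ℝ^d) have finite second moments and the W_2(μ,ν) problem admits an optimal map T* = ∇φ, where φ : ℝ^d → ℝ is convex and twice differentiable with Hessian satisfying Hφ(x) ⪯ L·I_d for all x (so ∇φ♯μ = ν and ∫‖x − ∇φ(x)‖² dμ = W_2(μ,ν)²). Then there is an absolute constant C such that, for every measurable map T, ‖T − T*‖²_{L²(μ)} ≤ C (L ∨ 1) · E_2(T;μ,ν) · (W_2(μ,ν) + E_2(T;μ,ν)). -/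
open MeasureTheory ProbabilityTheory Set

noncomputable section

abbrev Rd (d : ℕ) : Type := EuclideanSpace ℝ (Fin d)

/-- `π` is a coupling of `μ` and `ν`. -/
def IsCoupling {d : ℕ} (π : Measure (Rd d × Rd d)) (μ ν : Measure (Rd d)) : Prop :=
  π.map Prod.fst = μ ∧ π.map Prod.snd = ν

/-- The `p`-Wasserstein distance between `μ` and `ν`. -/
noncomputable def Wp {d : ℕ} (p : ℝ) (μ ν : Measure (Rd d)) : ℝ :=
  sInf { c : ℝ | ∃ π : Measure (Rd d × Rd d), IsCoupling π μ ν ∧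
    c = (∫ z, ‖z.1 - z.2‖ ^ p ∂π) ^ (1 / p) }

/-- The transport cost `(∫∫ ‖x-y‖^p dκ_x(y) dμ(x))^{1/p}` of a kernel. -/
noncomputable def kernelCost {d : ℕ} (p : ℝ) (κ : Kernel (Rd d) (Rd d))
    (μ : Measure (Rd d)) : ℝ :=
  (∫ x, ∫ y, ‖x - y‖ ^ p ∂(κ x) ∂μ) ^ (1 / p)

/-- Pushforward of `μ` by the kernel `κ`. -/
noncomputable def kpush {d : ℕ} (κ : Kernel (Rd d) (Rd d)) (μ : Measure (Rd d)) :
    Measure (Rd d) :=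
  μ.bind fun x => κ x

/-- The transportation error `E_p(κ; μ, ν)`: optimality gap plus feasibility gap. -/
noncomputable def Ep {d : ℕ} (p : ℝ) (κ : Kernel (Rd d) (Rd d)) (μ ν : Measure (Rd d)) : ℝ :=
  max (kernelCost p κ μ - Wp p μ ν) 0 + Wp p (kpush κ μ) ν

/-- Total variation distance between measures. -/
noncomputable def tvDist {α : Type*} [MeasurableSpace α] (μ ν : Measure α) : ℝ :=
  sSup { r : ℝ | ∃ A : Set α, MeasurableSet A ∧ r = |(μ A).toReal - (ν A).toReal| }

/-- Finite `p`-th moment. -/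
def HasFiniteMoment {d : ℕ} (p : ℝ) (μ : Measure (Rd d)) : Prop :=
  Integrable (fun x => ‖x‖ ^ p) μ


section ConvexAnalysis

open RealInnerProductSpace Filter Topology

variable {E : Type*} [NormedAddCommGroup E] [InnerProductSpace ℝ E]

lemma HasGradientAt.hasDerivAt_line [CompleteSpace E] {φ : E → ℝ} {g x v : E} {t : ℝ}
    (h : HasGradientAt φ g (x + t • v)) :
    HasDerivAt (fun s : ℝ => φ (x + s • v)) ⟪g, v⟫ t := by
  have hl : HasDerivAt (fun s : ℝ => x + s • v) v t := by
    simpa using ((hasDerivAt_id t).smul_const v).const_add x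
  have := h.hasFDerivAt.comp_hasDerivAt t hl
  rw [InnerProductSpace.toDual_apply_apply] at this
  exact this

lemma ConvexOn.add_inner_le_of_hasGradientAt [CompleteSpace E] {φ : E → ℝ} {g y : E}
    (hφ : ConvexOn ℝ univ φ) (h : HasGradientAt φ g y) (x : E) :
    φ y + ⟪g, x - y⟫ ≤ φ x := by
  have hc : ConvexOn ℝ univ (fun s : ℝ => φ (y + s • (x - y))) := by
    have := hφ.comp_affineMap (AffineMap.lineMap (k := ℝ) y x)
    refine (this.congr ?_)
    intro s _
    simp [AffineMap.lineMap_apply, add_comm]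
  have hd : HasDerivAt (fun s : ℝ => φ (y + s • (x - y))) ⟪g, x - y⟫ 0 :=
    HasGradientAt.hasDerivAt_line (by simpa using h)
  have := hc.le_slope_of_hasDerivAt (mem_univ 0) (mem_univ 1) one_pos hd
  simp [slope_def_field] at this
  linarith

lemma LocallyLipschitz.dense_differentiableAt {F : Type*} [NormedAddCommGroup F] [NormedSpace ℝ F]
    [FiniteDimensional ℝ F] {φ : F → ℝ} (hφ : LocallyLipschitz φ) :
    Dense {x | DifferentiableAt ℝ φ x} := by
  borelize F
  intro x
  rw [mem_closure_iff]
  intro o ho hxo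
  obtain ⟨K, t, ht, hK⟩ := hφ x
  have hu : (o ∩ interior t).Nonempty := ⟨x, hxo, mem_interior_iff_mem_nhds.2 ht⟩
  have hopen : IsOpen (o ∩ interior t) := ho.inter isOpen_interior
  have hd := (hK.mono interior_subset).ae_differentiableWithinAt_of_mem
    (μ := Measure.addHaar (G := F))
  obtain ⟨y, ⟨hyo, hyt⟩, hy⟩ := (Measure.dense_of_ae hd).inter_open_nonempty _ hopen hu
  exact ⟨y, hyo, (hy hyt).differentiableAt (isOpen_interior.mem_nhds hyt)⟩

/-- If the gradient of a convex function is continuous (with the junk value `0` at points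
of nondifferentiability), then it is a subgradient everywhere. -/
lemma ConvexOn.add_inner_gradient_le [FiniteDimensional ℝ E] {φ : E → ℝ}
    (hφ : ConvexOn ℝ univ φ) (hc : Continuous (gradient φ)) (y x : E) :
    φ y + ⟪gradient φ y, x - y⟫ ≤ φ x := by
  have hL : LocallyLipschitz φ := hφ.locallyLipschitz
  have hφc : Continuous φ := hL.continuous
  have hclosed : IsClosed {y | φ y + ⟪gradient φ y, x - y⟫ ≤ φ x} :=
    isClosed_le (by fun_prop) continuous_const
  have hsub : {y | DifferentiableAt ℝ φ y} ⊆ {y | φ y + ⟪gradient φ y, x - y⟫ ≤ φ x} :=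
    fun z hz => hφ.add_inner_le_of_hasGradientAt hz.hasGradientAt x
  exact hclosed.closure_subset_iff.2 hsub (hL.dense_differentiableAt y)

lemma ConvexOn.hasGradientAt_of_continuous_gradient [FiniteDimensional ℝ E] {φ : E → ℝ}
    (hφ : ConvexOn ℝ univ φ) (hc : Continuous (gradient φ)) (y : E) :
    HasGradientAt φ (gradient φ y) y := by
  rw [hasGradientAt_iff_isLittleO, Asymptotics.isLittleO_iff]
  intro c hcpos
  have hev : ∀ᶠ x in 𝓝 y, ‖gradient φ x - gradient φ y‖ < c := by
    have := (Metric.tendsto_nhds.1 (hc.tendsto y)) c hcpos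
    simpa [dist_eq_norm] using this
  filter_upwards [hev] with x hx
  have h1 := hφ.add_inner_gradient_le hc y x
  have h2 := hφ.add_inner_gradient_le hc x y
  have h3 : ⟪gradient φ x, y - x⟫ = -⟪gradient φ x, x - y⟫ := by
    rw [← neg_sub x y, inner_neg_right]
  have h4 := real_inner_le_norm (gradient φ x - gradient φ y) (x - y)
  rw [inner_sub_left] at h4
  have h5 : ‖gradient φ x - gradient φ y‖ * ‖x - y‖ ≤ c * ‖x - y‖ := by gcongr
  rw [Real.norm_eq_abs, abs_le]
  constructor <;> nlinarith [norm_nonneg (x - y)]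

lemma le_add_inner_add_sq_of_hessian_le [CompleteSpace E] {φ : E → ℝ} {S : E → E}
    {H : E → E →L[ℝ] E} {M : ℝ} (hS : ∀ x, HasGradientAt φ (S x) x)
    (hH : ∀ x, HasFDerivAt S (H x) x) (hM : ∀ x v, ⟪v, H x v⟫ ≤ M * ‖v‖ ^ 2) (x v : E) :
    φ (x + v) ≤ φ x + ⟪S x, v⟫ + M / 2 * ‖v‖ ^ 2 := by
  set h : ℝ → ℝ := fun t => M / 2 * ‖v‖ ^ 2 * t ^ 2 - φ (x + t • v) with hh
  have hd : ∀ t, HasDerivAt h (M * ‖v‖ ^ 2 * t - ⟪S (x + t • v), v⟫) t := by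
    intro t
    have h1 := ((hasDerivAt_pow 2 t).const_mul (M / 2 * ‖v‖ ^ 2)).sub
      (hS (x + t • v)).hasDerivAt_line
    refine h1.congr_deriv ?_
    push_cast
    ring
  have hd2 : ∀ t, HasDerivAt (fun t => M * ‖v‖ ^ 2 * t - ⟪S (x + t • v), v⟫)
      (M * ‖v‖ ^ 2 - ⟪H (x + t • v) v, v⟫) t := by
    intro t
    have hl : HasDerivAt (fun s : ℝ => x + s • v) v t := by
      simpa using ((hasDerivAt_id t).smul_const v).const_add x
    have h2 := (hH (x + t • v)).comp_hasDerivAt t hl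
    have h3 := h2.inner ℝ (hasDerivAt_const t v)
    have h4 := ((hasDerivAt_id t).const_mul (M * ‖v‖ ^ 2)).sub h3
    rw [inner_zero_right, zero_add, mul_one] at h4
    exact h4
  have hderiv : deriv h = fun t => M * ‖v‖ ^ 2 * t - ⟪S (x + t • v), v⟫ :=
    funext fun t => (hd t).deriv
  have hmono : Monotone (deriv h) := by
    rw [hderiv]
    refine monotone_of_deriv_nonneg (fun t => (hd2 t).differentiableAt) fun t => ?_
    rw [(hd2 t).deriv, real_inner_comm]
    linarith [hM (x + t • v) v]
  have hconv := hmono.convexOn_univ_of_deriv fun t => (hd t).differentiableAt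
  have := hconv.le_slope_of_hasDerivAt (mem_univ 0) (mem_univ 1) one_pos (hd 0)
  simp [slope_def_field, hh] at this
  linarith

/-- Co-coercivity of the gradient of a convex function with Hessian bounded above. -/
lemma ConvexOn.add_inner_add_sq_le_of_hessian_le [CompleteSpace E] {φ : E → ℝ} {S : E → E}
    {H : E → E →L[ℝ] E} {M : ℝ} (hφ : ConvexOn ℝ univ φ) (hMpos : 0 < M)
    (hS : ∀ x, HasGradientAt φ (S x) x) (hH : ∀ x, HasFDerivAt S (H x) x)
    (hM : ∀ x v, ⟪v, H x v⟫ ≤ M * ‖v‖ ^ 2) (x y : E) :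
    φ y + ⟪S y, x - y⟫ + 1 / (2 * M) * ‖S x - S y‖ ^ 2 ≤ φ x := by
  have h1 := hφ.add_inner_le_of_hasGradientAt (hS y) (x + (-M⁻¹) • (S x - S y))
  have h2 := le_add_inner_add_sq_of_hessian_le hS hH hM x ((-M⁻¹) • (S x - S y))
  rw [add_sub_right_comm, inner_add_right, real_inner_smul_right] at h1
  rw [real_inner_smul_right, norm_smul, mul_pow, Real.norm_eq_abs, sq_abs] at h2
  have h3 : ⟪S x, S x - S y⟫ - ⟪S y, S x - S y⟫ = ‖S x - S y‖ ^ 2 := by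
    rw [← inner_sub_left, real_inner_self_eq_norm_sq]
  have h4 : M / 2 * ((-M⁻¹) ^ 2 * ‖S x - S y‖ ^ 2) = 1 / (2 * M) * ‖S x - S y‖ ^ 2 := by
    field_simp
  have h5 : M⁻¹ * ⟪S x, S x - S y⟫ - M⁻¹ * ⟪S y, S x - S y⟫
      = 2 * (1 / (2 * M) * ‖S x - S y‖ ^ 2) := by
    rw [← mul_sub, h3]
    field_simp
  linarith

end ConvexAnalysis

section Couplings

/-- A measure on a product whose first marginal is a pushforward `μ.map f` lifts along `f`. -/
lemma exists_lift_fst {X Y Z : Type*} [MeasurableSpace X] [MeasurableSpace Y] [MeasurableSpace Z]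
    [StandardBorelSpace Z] [Nonempty Z] {μ : Measure X} [IsProbabilityMeasure μ]
    {f : X → Y} (hf : Measurable f) {γ : Measure (Y × Z)} [IsFiniteMeasure γ]
    (hγ : γ.map Prod.fst = μ.map f) :
    ∃ π : Measure (X × Z), π.map Prod.fst = μ ∧ π.map (Prod.map f id) = γ := by
  refine ⟨μ ⊗ₘ (γ.condKernel.comap f hf), ?_, ?_⟩
  · exact Measure.fst_compProd μ _
  · have hdis : γ.map Prod.fst ⊗ₘ γ.condKernel = γ := γ.disintegrate γ.condKernel
    refine Measure.ext fun s hs => ?_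
    conv_rhs => rw [← hdis]
    rw [hγ, Measure.map_apply (by fun_prop) hs, Measure.compProd_apply (by measurability)]
    have := Measure.isProbabilityMeasure_map (μ := μ) hf.aemeasurable
    rw [Measure.compProd_apply hs, lintegral_map (Kernel.measurable_kernel_prodMk_left hs) hf]
    rfl

/-- A coupling of two pushforwards lifts to a coupling of the original measures. -/
lemma exists_lift_coupling {X Y Z W : Type*} [MeasurableSpace X] [MeasurableSpace Y]
    [MeasurableSpace Z] [MeasurableSpace W] [StandardBorelSpace Z] [Nonempty Z]
    [StandardBorelSpace X] [Nonempty X]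
    {μ : Measure X} {ν : Measure W} [IsProbabilityMeasure μ] [IsProbabilityMeasure ν]
    {f : X → Y} (hf : Measurable f) {g : W → Z} (hg : Measurable g)
    {γ : Measure (Y × Z)} (h1 : γ.map Prod.fst = μ.map f) (h2 : γ.map Prod.snd = ν.map g) :
    ∃ π : Measure (X × W), π.map Prod.fst = μ ∧ π.map Prod.snd = ν ∧
      π.map (Prod.map f g) = γ := by
  have hγ : IsProbabilityMeasure γ := by
    have := Measure.isProbabilityMeasure_map (μ := μ) hf.aemeasurable
    rw [← h1] at this
    exact Measure.isProbabilityMeasure_of_map Prod.fst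
  obtain ⟨π₁, h3, h4⟩ := exists_lift_fst hf h1
  have hπ₁ : IsProbabilityMeasure π₁ := by
    have : IsProbabilityMeasure (π₁.map Prod.fst) := by rw [h3]; infer_instance
    exact Measure.isProbabilityMeasure_of_map Prod.fst
  have h5 : (π₁.map Prod.swap).map Prod.fst = ν.map g := by
    rw [Measure.map_map (by fun_prop) (by fun_prop), ← h2, ← h4,
      Measure.map_map (by fun_prop) (by fun_prop)]
    rfl
  obtain ⟨π₂, h6, h7⟩ := exists_lift_fst hg h5
  refine ⟨π₂.map Prod.swap, ?_, ?_, ?_⟩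
  · rw [Measure.map_map (by fun_prop) (by fun_prop), ← h3]
    have : π₁ = (π₁.map Prod.swap).map Prod.swap := by
      rw [Measure.map_map (by fun_prop) (by fun_prop)]; simp
    rw [this, ← h7, Measure.map_map (by fun_prop) (by fun_prop),
      Measure.map_map (by fun_prop) (by fun_prop)]
    rfl
  · rw [Measure.map_map (by fun_prop) (by fun_prop), ← h6]
    rfl
  · rw [← h4, Measure.map_map (by fun_prop) (by fun_prop)]
    have : π₁ = (π₁.map Prod.swap).map Prod.swap := by
      rw [Measure.map_map (by fun_prop) (by fun_prop)]; simp
    rw [this, ← h7, Measure.map_map (by fun_prop) (by fun_prop),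
      Measure.map_map (by fun_prop) (by fun_prop)]
    rfl

end Couplings

/-- Minkowski's inequality in `L²`, in squared form. -/
lemma integral_norm_add_sq_le {Ω E : Type*} [MeasurableSpace Ω] [NormedAddCommGroup E]
    {π : Measure Ω} {f g : Ω → E} (hf : MemLp f 2 π) (hg : MemLp g 2 π) {a b : ℝ}
    (ha : 0 ≤ a) (hb : 0 ≤ b)
    (hfa : ∫ x, ‖f x‖ ^ 2 ∂π ≤ a ^ 2) (hgb : ∫ x, ‖g x‖ ^ 2 ∂π ≤ b ^ 2) :
    ∫ x, ‖f x + g x‖ ^ 2 ∂π ≤ (a + b) ^ 2 := by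
  have key : ∀ {h : Ω → E}, MemLp h 2 π →
      eLpNorm h 2 π = ENNReal.ofReal (√(∫ x, ‖h x‖ ^ 2 ∂π)) := by
    intro h hh
    rw [hh.eLpNorm_eq_integral_rpow_norm (by simp) (by simp), Real.sqrt_eq_rpow]
    simp
  have h1 := eLpNorm_add_le hf.1 hg.1 (p := 2) (by simp)
  rw [key hf, key hg, key (hf.add hg), ← ENNReal.ofReal_add (by positivity) (by positivity),
    ENNReal.ofReal_le_ofReal_iff (by positivity)] at h1
  have h2 : √(∫ x, ‖f x‖ ^ 2 ∂π) ≤ a := Real.sqrt_le_iff.2 ⟨ha, hfa⟩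
  have h3 : √(∫ x, ‖g x‖ ^ 2 ∂π) ≤ b := Real.sqrt_le_iff.2 ⟨hb, hgb⟩
  exact (Real.sqrt_le_left (by positivity)).1 (h1.trans (add_le_add h2 h3))

section Transport

open RealInnerProductSpace Filter Topology

variable {E : Type*} [NormedAddCommGroup E] [InnerProductSpace ℝ E] [MeasurableSpace E]
  [BorelSpace E] [FiniteDimensional ℝ E]

/-- Stability of a smooth Brenier map: replacing the optimal coupling of `μ` and `S♯μ` by another
one, `(x, S x')` with `(x, x') ∼ π`, costs at least `M⁻¹ ∫ ‖S x - S x'‖² dπ`. -/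
lemma integral_gradient_sub_sq_le {μ : Measure E} [IsProbabilityMeasure μ] {φ : E → ℝ} {S : E → E}
    {H : E → E →L[ℝ] E} {M : ℝ} (hφ : ConvexOn ℝ univ φ) (hM0 : 0 < M)
    (hS : ∀ x, HasGradientAt φ (S x) x) (hH : ∀ x, HasFDerivAt S (H x) x)
    (hM : ∀ x v, ⟪v, H x v⟫ ≤ M * ‖v‖ ^ 2)
    (hid : MemLp (fun x : E => x) 2 μ) (hSmem : MemLp S 2 μ)
    {π : Measure (E × E)} (h1 : π.map Prod.fst = μ) (h2 : π.map Prod.snd = μ) :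
    ∫ z, ‖S z.1 - S z.2‖ ^ 2 ∂π ≤
      M * (∫ z, ‖z.1 - S z.2‖ ^ 2 ∂π - ∫ x, ‖x - S x‖ ^ 2 ∂μ) := by
  have hπ : IsProbabilityMeasure π := by
    have : IsProbabilityMeasure (π.map Prod.fst) := by rwa [h1]
    exact Measure.isProbabilityMeasure_of_map Prod.fst
  have m1 : MeasurePreserving Prod.fst π μ := ⟨measurable_fst, h1⟩
  have m2 : MeasurePreserving Prod.snd π μ := ⟨measurable_snd, h2⟩
  have hφc : Continuous φ := hφ.locallyLipschitz.continuous
  have hφi : Integrable φ μ := by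
    refine integrable_of_le_of_le (g₁ := fun x => φ 0 + ⟪S 0, x⟫)
      (g₂ := fun x => φ 0 + (‖S x‖ ^ 2 + ‖x‖ ^ 2)) hφc.aestronglyMeasurable (ae_of_all _ fun x => ?_)
      (ae_of_all _ fun x => ?_) ?_ ?_
    · simpa using hφ.add_inner_le_of_hasGradientAt (hS 0) x
    · have := hφ.add_inner_le_of_hasGradientAt (hS x) 0
      simp only [zero_sub, inner_neg_right] at this
      nlinarith [real_inner_le_norm (S x) x, sq_nonneg (‖S x‖ - ‖x‖), sq_nonneg (‖S x‖ + ‖x‖)]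
    · exact (integrable_const _).add ((hid.integrable (by simp)).const_inner _)
    · exact (integrable_const _).add (hSmem.integrable_norm_pow'.add hid.integrable_norm_pow')
  set ψ : E → ℝ := fun x => 2 * φ x - ‖x‖ ^ 2 with hψ
  have hψi : Integrable ψ μ := (hφi.const_mul 2).sub hid.integrable_norm_pow'
  have hψ1 : Integrable (fun z : E × E => ψ z.1) π := m1.integrable_comp_of_integrable hψi
  have hψ2 : Integrable (fun z : E × E => ψ z.2) π := m2.integrable_comp_of_integrable hψi
  have hψeq : ∫ z, ψ z.1 ∂π = ∫ z, ψ z.2 ∂π := by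
    rw [← integral_map measurable_fst.aemeasurable (by rw [h1]; exact hψi.1),
      ← integral_map measurable_snd.aemeasurable (by rw [h2]; exact hψi.1), h1, h2]
  have hdi : MemLp (fun x => x - S x) 2 μ := hid.sub hSmem
  have hdeq : ∫ x, ‖x - S x‖ ^ 2 ∂μ = ∫ z, ‖z.2 - S z.2‖ ^ 2 ∂π := by
    rw [← integral_map (f := fun x => ‖x - S x‖ ^ 2) measurable_snd.aemeasurable
      (by rw [h2]; exact hdi.integrable_norm_pow'.1), h2]
  have i1 : Integrable (fun z : E × E => ‖S z.1 - S z.2‖ ^ 2) π :=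
    ((hSmem.comp_measurePreserving m1).sub (hSmem.comp_measurePreserving m2)).integrable_norm_pow'
  have i2 : Integrable (fun z : E × E => ‖z.1 - S z.2‖ ^ 2) π :=
    ((hid.comp_measurePreserving m1).sub (hSmem.comp_measurePreserving m2)).integrable_norm_pow'
  have i3 : Integrable (fun z : E × E => ‖z.2 - S z.2‖ ^ 2) π :=
    (hdi.comp_measurePreserving m2).integrable_norm_pow'
  have hpt : ∀ z : E × E, ‖S z.1 - S z.2‖ ^ 2 ≤
      M * ((ψ z.1 - ψ z.2) + (‖z.1 - S z.2‖ ^ 2 - ‖z.2 - S z.2‖ ^ 2)) := by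
    rintro ⟨x, y⟩
    have h := hφ.add_inner_add_sq_le_of_hessian_le hM0 hS hH hM x y
    have h3 := norm_sub_sq_real x (S y)
    have h4 := norm_sub_sq_real y (S y)
    rw [inner_sub_right, real_inner_comm x (S y), real_inner_comm y (S y)] at h
    have h5 : ‖S x - S y‖ ^ 2 = M * (2 * (1 / (2 * M) * ‖S x - S y‖ ^ 2)) := by
      field_simp
    simp only [hψ]
    rw [h5]
    gcongr
    linarith
  calc ∫ z, ‖S z.1 - S z.2‖ ^ 2 ∂π
      ≤ ∫ z, M * ((ψ z.1 - ψ z.2) + (‖z.1 - S z.2‖ ^ 2 - ‖z.2 - S z.2‖ ^ 2)) ∂π :=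
        integral_mono i1 (((hψ1.sub hψ2).add (i2.sub i3)).const_mul M) hpt
    _ = M * (∫ z, ‖z.1 - S z.2‖ ^ 2 ∂π - ∫ x, ‖x - S x‖ ^ 2 ∂μ) := by
        rw [integral_const_mul, integral_add (f := fun z : E × E => ψ z.1 - ψ z.2)
          (g := fun z : E × E => ‖z.1 - S z.2‖ ^ 2 - ‖z.2 - S z.2‖ ^ 2) (hψ1.sub hψ2)
          (i2.sub i3), integral_sub hψ1 hψ2, integral_sub i2 i3, hψeq, hdeq, sub_self, zero_add]

/-- If `(x, x') ∼ π` is a coupling of `μ` with itself, the squared `L²` distance from `T` to the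
Brenier map `S` is controlled by the cost of `T` and the cost of the coupling `(T x, S x')`. -/
lemma integral_sub_gradient_sq_le {μ : Measure E} [IsProbabilityMeasure μ] {φ : E → ℝ} {S : E → E}
    {H : E → E →L[ℝ] E} {M : ℝ} (hφ : ConvexOn ℝ univ φ) (hM1 : 1 ≤ M)
    (hS : ∀ x, HasGradientAt φ (S x) x) (hH : ∀ x, HasFDerivAt S (H x) x)
    (hM : ∀ x v, ⟪v, H x v⟫ ≤ M * ‖v‖ ^ 2)
    (hid : MemLp (fun x : E => x) 2 μ) (hSmem : MemLp S 2 μ)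
    {T : E → E} (hT : MemLp T 2 μ)
    {π : Measure (E × E)} (h1 : π.map Prod.fst = μ) (h2 : π.map Prod.snd = μ)
    {w k n e : ℝ} (hk : 0 ≤ k) (hn : 0 ≤ n)
    (hwS : ∫ x, ‖x - S x‖ ^ 2 ∂μ = w ^ 2) (hkT : ∫ x, ‖x - T x‖ ^ 2 ∂μ ≤ k ^ 2)
    (hnπ : ∫ z, ‖T z.1 - S z.2‖ ^ 2 ∂π ≤ n ^ 2) (hne : n ≤ e) (hkn : k + n ≤ w + e) :
    ∫ x, ‖T x - S x‖ ^ 2 ∂μ ≤ 4 * M * e * (w + e) := by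
  have hπ : IsProbabilityMeasure π := by
    have : IsProbabilityMeasure (π.map Prod.fst) := by rwa [h1]
    exact Measure.isProbabilityMeasure_of_map Prod.fst
  have m1 : MeasurePreserving Prod.fst π μ := ⟨measurable_fst, h1⟩
  have m2 : MeasurePreserving Prod.snd π μ := ⟨measurable_snd, h2⟩
  have hS1 := hSmem.comp_measurePreserving m1
  have hS2 := hSmem.comp_measurePreserving m2
  have hT1 := hT.comp_measurePreserving m1
  have hTS := hT1.sub hS2
  have hstab := integral_gradient_sub_sq_le hφ (by linarith) hS hH hM hid hSmem h1 h2
  have hkT' : ∫ z, ‖z.1 - T z.1‖ ^ 2 ∂π ≤ k ^ 2 := by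
    rwa [← integral_map (f := fun x => ‖x - T x‖ ^ 2) measurable_fst.aemeasurable
      (by rw [h1]; exact (hid.sub hT).integrable_norm_pow'.1), h1]
  have hA : ∫ z, ‖z.1 - S z.2‖ ^ 2 ∂π ≤ (k + n) ^ 2 := by
    simpa using integral_norm_add_sq_le ((hid.sub hT).comp_measurePreserving m1) hTS hk hn hkT' hnπ
  have hB : ∫ x, ‖T x - S x‖ ^ 2 ∂μ ≤
      2 * (∫ z, ‖T z.1 - S z.2‖ ^ 2 ∂π) + 2 * ∫ z, ‖S z.1 - S z.2‖ ^ 2 ∂π := by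
    have heq : ∫ x, ‖T x - S x‖ ^ 2 ∂μ = ∫ z, ‖T z.1 - S z.1‖ ^ 2 ∂π := by
      rw [← integral_map (f := fun x => ‖T x - S x‖ ^ 2) measurable_fst.aemeasurable
        (by rw [h1]; exact (hT.sub hSmem).integrable_norm_pow'.1), h1]
    have i1 : Integrable (fun z : E × E => ‖T z.1 - S z.2‖ ^ 2) π := hTS.integrable_norm_pow'
    have i2 : Integrable (fun z : E × E => ‖S z.1 - S z.2‖ ^ 2) π :=
      (hS1.sub hS2).integrable_norm_pow'
    rw [heq, ← integral_const_mul, ← integral_const_mul,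
      ← integral_add (i1.const_mul 2) (i2.const_mul 2)]
    refine integral_mono (hT1.sub hS1).integrable_norm_pow'
      ((i1.const_mul 2).add (i2.const_mul 2)) fun z => ?_
    have h3 := norm_sub_le (T z.1 - S z.2) (S z.1 - S z.2)
    rw [sub_sub_sub_cancel_right] at h3
    have h4 := pow_le_pow_left₀ (norm_nonneg _) h3 2
    simp only
    nlinarith [sq_nonneg (‖T z.1 - S z.2‖ - ‖S z.1 - S z.2‖)]
  have he : 0 ≤ e := hn.trans hne
  have h5 : (k + n) ^ 2 ≤ (w + e) ^ 2 := by gcongr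
  have h6 : n ^ 2 ≤ e ^ 2 := by gcongr
  have h7 : M * (∫ z, ‖z.1 - S z.2‖ ^ 2 ∂π - ∫ x, ‖x - S x‖ ^ 2 ∂μ)
      ≤ M * ((w + e) ^ 2 - w ^ 2) := by
    gcongr
    · exact hA.trans h5
    · exact hwS.ge
  have h8 : e ^ 2 ≤ M * e ^ 2 := le_mul_of_one_le_left (sq_nonneg e) hM1
  linarith

end Transport

lemma Wp_nonneg {d : ℕ} (p : ℝ) (μ ν : Measure (Rd d)) : 0 ≤ Wp p μ ν := by
  refine Real.sInf_nonneg ?_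
  rintro c ⟨π, -, rfl⟩
  exact Real.rpow_nonneg (integral_nonneg fun z => by positivity) _

lemma Ep_nonneg {d : ℕ} (p : ℝ) (κ : Kernel (Rd d) (Rd d)) (μ ν : Measure (Rd d)) :
    0 ≤ Ep p κ μ ν :=
  add_nonneg (le_max_right _ _) (Wp_nonneg _ _ _)

lemma exists_isCoupling_lt_of_Wp_lt {d : ℕ} {μ ν : Measure (Rd d)} [IsProbabilityMeasure μ]
    [IsProbabilityMeasure ν] {n : ℝ} (hn : Wp 2 μ ν < n) :
    ∃ γ, IsCoupling γ μ ν ∧ ∫ z, ‖z.1 - z.2‖ ^ 2 ∂γ ≤ n ^ 2 := by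
  have hne : { c : ℝ | ∃ π : Measure (Rd d × Rd d), IsCoupling π μ ν ∧
      c = (∫ z, ‖z.1 - z.2‖ ^ (2 : ℝ) ∂π) ^ (1 / (2 : ℝ)) }.Nonempty :=
    ⟨_, μ.prod ν, ⟨Measure.fst_prod, Measure.snd_prod⟩, rfl⟩
  obtain ⟨c, ⟨γ, hγ, rfl⟩, hlt⟩ := exists_lt_of_csInf_lt hne hn
  refine ⟨γ, hγ, ?_⟩
  simp only [Real.rpow_two] at hlt
  rw [← Real.sqrt_eq_rpow] at hlt
  exact (Real.sqrt_le_left ((Real.sqrt_nonneg _).trans hlt.le)).1 hlt.le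

open RealInnerProductSpace in
/-- Reverse `L²` comparison: if the `W₂(μ,ν)` problem admits an optimal map
`T⋆ = ∇φ` for a convex, twice differentiable potential `φ` with Hessian `⪯ L·I`, then for an
absolute constant `C`, every measurable map `T` satisfies
`‖T − T⋆‖²_{L²(μ)} ≤ C (L ∨ 1) E₂(T;μ,ν) (W₂(μ,ν) + E₂(T;μ,ν))`. -/
theorem reverse_L2_comparison :
    ∃ C : ℝ, 0 < C ∧
      ∀ {d : ℕ}, 1 ≤ d →
      ∀ (μ ν : Measure (Rd d)), IsProbabilityMeasure μ → IsProbabilityMeasure ν →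
      HasFiniteMoment 2 μ → HasFiniteMoment 2 ν →
      ∀ (L : ℝ) (φ : Rd d → ℝ) (Hφ : Rd d → (Rd d →L[ℝ] Rd d)),
        ConvexOn ℝ Set.univ φ →
        (∀ x, HasFDerivAt (fun y => gradient φ y) (Hφ x) x) →
        (∀ x v, ⟪v, Hφ x v⟫ ≤ L * ‖v‖ ^ 2) →
        μ.map (fun x => gradient φ x) = ν →
        (∫ x, ‖x - gradient φ x‖ ^ (2 : ℝ) ∂μ) = Wp 2 μ ν ^ 2 →
      ∀ (T : Rd d → Rd d) (hT : Measurable T),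
        (∫ x, ‖T x - gradient φ x‖ ^ (2 : ℝ) ∂μ) ≤
          C * (max L 1) * Ep 2 (Kernel.deterministic T hT) μ ν *
            (Wp 2 μ ν + Ep 2 (Kernel.deterministic T hT) μ ν) := by
  refine ⟨4, by norm_num, ?_⟩
  intro d _ μ ν _ _ hμ hν L φ H hφ hH hL hpush hopt T hT
  simp only [Real.rpow_two] at hopt ⊢
  simp only [HasFiniteMoment, Real.rpow_two] at hμ hν
  have hE := Ep_nonneg 2 (Kernel.deterministic T hT) μ ν
  have hW := Wp_nonneg 2 μ ν
  have hSc : Continuous (gradient φ) := continuous_iff_continuousAt.2 fun x => (hH x).continuousAt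
  have hid : MemLp (fun x : Rd d => x) 2 μ :=
    (memLp_two_iff_integrable_sq_norm aestronglyMeasurable_id).2 hμ
  have hSmem : MemLp (gradient φ) 2 μ := by
    refine (memLp_two_iff_integrable_sq_norm hSc.aestronglyMeasurable).2 ?_
    rw [← hpush] at hν
    exact (integrable_map_measure hν.1 hSc.aemeasurable).1 hν
  by_cases hint : Integrable (fun x => ‖T x - gradient φ x‖ ^ 2) μ
  swap
  · rw [integral_undef hint]
    positivity
  have hTmem : MemLp T 2 μ := by
    have h := (memLp_two_iff_integrable_sq_norm
      (hT.aestronglyMeasurable.sub hSc.aestronglyMeasurable)).2 hint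
    simpa using h.add hSmem
  have hM : ∀ x v, ⟪v, H x v⟫ ≤ max L 1 * ‖v‖ ^ 2 := fun x v =>
    (hL x v).trans (mul_le_mul_of_nonneg_right (le_max_left _ _) (sq_nonneg _))
  have hkpush : kpush (Kernel.deterministic T hT) μ = μ.map T := Measure.bind_dirac_eq_map μ hT
  have hTprob : IsProbabilityMeasure (μ.map T) :=
    Measure.isProbabilityMeasure_map hT.aemeasurable
  have hcost : kernelCost 2 (Kernel.deterministic T hT) μ = √(∫ x, ‖x - T x‖ ^ 2 ∂μ) := by
    simp [kernelCost, Kernel.deterministic_apply, Real.sqrt_eq_rpow]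
  have key : ∀ ε > 0, ∫ x, ‖T x - gradient φ x‖ ^ 2 ∂μ ≤
      4 * max L 1 * (Ep 2 (Kernel.deterministic T hT) μ ν + ε) *
        (Wp 2 μ ν + (Ep 2 (Kernel.deterministic T hT) μ ν + ε)) := by
    intro ε hε
    have hN := Wp_nonneg 2 (μ.map T) ν
    obtain ⟨γ, ⟨hγ1, hγ2⟩, hγ⟩ :=
      exists_isCoupling_lt_of_Wp_lt (lt_add_of_pos_right (Wp 2 (μ.map T) ν) hε)
    obtain ⟨π, hπ1, hπ2, rfl⟩ :=
      exists_lift_coupling hT hSc.measurable hγ1 (hγ2.trans hpush.symm)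
    rw [integral_map (hT.prodMap hSc.measurable).aemeasurable (by fun_prop)] at hγ
    have hgap := le_max_left (kernelCost 2 (Kernel.deterministic T hT) μ - Wp 2 μ ν) 0
    have hgap0 := le_max_right (kernelCost 2 (Kernel.deterministic T hT) μ - Wp 2 μ ν) 0
    refine integral_sub_gradient_sq_le hφ (le_max_right L 1)
      (hφ.hasGradientAt_of_continuous_gradient hSc) hH hM hid hSmem hTmem hπ1 hπ2
      (Real.sqrt_nonneg (∫ x, ‖x - T x‖ ^ 2 ∂μ)) (by positivity) hopt ?_ hγ ?_ ?_
    · rw [Real.sq_sqrt (by positivity)]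
    · rw [Ep, hkpush]
      linarith
    · rw [Ep, hkpush, ← hcost]
      linarith
  have hlim : Filter.Tendsto (fun ε : ℝ => 4 * max L 1 *
      (Ep 2 (Kernel.deterministic T hT) μ ν + ε) *
        (Wp 2 μ ν + (Ep 2 (Kernel.deterministic T hT) μ ν + ε))) (nhdsWithin 0 (Ioi 0))
      (nhds (4 * max L 1 * Ep 2 (Kernel.deterministic T hT) μ ν *
        (Wp 2 μ ν + Ep 2 (Kernel.deterministic T hT) μ ν))) := by
    refine Filter.Tendsto.mono_left ?_ nhdsWithin_le_nhds
    refine Continuous.tendsto' (by fun_prop) _ _ (by simp)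
  exact ge_of_tendsto hlim (Filter.eventually_of_mem self_mem_nhdsWithin key)
end
end

section
/- Fix μ ∈ P(X) and ν, ν' ∈ P(Y), all with finite p-th moments. For every Markov kernel κ from X to Y, |E_p(κ;μ,ν) − E_p(κ;μ,ν')| ≤ 2 W_p(ν,ν') ≤ 2 diam(Y) ‖ν − ν'‖_TV^{1/p}. -/
open MeasureTheory ProbabilityTheory Set

noncomputable section

/-- The difference of coordinates under a coupling of measures with finite `p`-th moments is in
`L^p`. -/
lemma IsCoupling.memLp_sub {d : ℕ} {p : ℝ} (hp : 1 ≤ p) {π : Measure (Rd d × Rd d)}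
    {μ ν : Measure (Rd d)} (h : IsCoupling π μ ν) (hμ : HasFiniteMoment p μ)
    (hν : HasFiniteMoment p ν) : MemLp (fun z => z.1 - z.2) (ENNReal.ofReal p) π := by
  have h0 : 0 < p := by linarith
  have key : ∀ ρ : Measure (Rd d), HasFiniteMoment p ρ →
      MemLp (fun x => x) (ENNReal.ofReal p) ρ := by
    intro ρ hρ
    rw [← integrable_norm_rpow_iff (by fun_prop) (by simpa using h0) ENNReal.ofReal_ne_top,
      ENNReal.toReal_ofReal h0.le]
    exact hρ
  exact ((key μ hμ).comp_measurePreserving ⟨measurable_fst, h.1⟩).sub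
    ((key ν hν).comp_measurePreserving ⟨measurable_snd, h.2⟩)

lemma integral_rpow_norm_eq_toReal_eLpNorm {Ω E : Type*} [MeasurableSpace Ω]
    [NormedAddCommGroup E] {p : ℝ} (hp : 1 ≤ p) {π : Measure Ω} {f : Ω → E}
    (hf : MemLp f (ENNReal.ofReal p) π) :
    (∫ z, ‖f z‖ ^ p ∂π) ^ (1 / p) = (eLpNorm f (ENNReal.ofReal p) π).toReal := by
  have h0 : 0 < p := by linarith
  rw [hf.eLpNorm_eq_integral_rpow_norm (by simpa using h0) ENNReal.ofReal_ne_top,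
    ENNReal.toReal_ofReal h0.le, ENNReal.toReal_ofReal (by positivity), one_div]

lemma Wp_le {d : ℕ} {p : ℝ} {π : Measure (Rd d × Rd d)} {μ ν : Measure (Rd d)}
    (h : IsCoupling π μ ν) : Wp p μ ν ≤ (∫ z, ‖z.1 - z.2‖ ^ p ∂π) ^ (1 / p) := by
  refine csInf_le ⟨0, ?_⟩ ⟨π, h, rfl⟩
  rintro _ ⟨π, -, rfl⟩
  positivity

lemma le_Wp {d : ℕ} {p c : ℝ} {μ ν : Measure (Rd d)} [IsProbabilityMeasure μ]
    [IsProbabilityMeasure ν] (h : ∀ π : Measure (Rd d × Rd d), IsCoupling π μ ν →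
      c ≤ (∫ z, ‖z.1 - z.2‖ ^ p ∂π) ^ (1 / p)) : c ≤ Wp p μ ν := by
  refine le_csInf ⟨_, μ.prod ν, ⟨?_, ?_⟩, rfl⟩ ?_
  · simp
  · simp
  · rintro _ ⟨π, hπ, rfl⟩
    exact h π hπ

lemma Wp_comm {d : ℕ} (p : ℝ) (μ ν : Measure (Rd d)) [IsProbabilityMeasure μ]
    [IsProbabilityMeasure ν] : Wp p μ ν = Wp p ν μ := by
  have key : ∀ μ ν : Measure (Rd d), [IsProbabilityMeasure μ] → [IsProbabilityMeasure ν] →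
      Wp p μ ν ≤ Wp p ν μ := by
    intro μ ν _ _
    refine le_Wp fun π hπ => ?_
    have hswap : IsCoupling (π.map Prod.swap) μ ν := by
      refine ⟨?_, ?_⟩
      · rw [Measure.map_map measurable_fst measurable_swap]; exact hπ.2
      · rw [Measure.map_map measurable_snd measurable_swap]; exact hπ.1
    refine (Wp_le hswap).trans_eq ?_
    rw [integral_map measurable_swap.aemeasurable (Measurable.aestronglyMeasurable (by fun_prop))]
    simp [norm_sub_rev]
  exact le_antisymm (key μ ν) (key ν μ)

/-- Gluing lemma: two couplings sharing a marginal are marginals of a common measure. -/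
lemma exists_gluing {d : ℕ} {μ ν ρ : Measure (Rd d)}
    {π₁ π₂ : Measure (Rd d × Rd d)} [IsFiniteMeasure π₁] [IsFiniteMeasure π₂]
    (h₁ : IsCoupling π₁ μ ν) (h₂ : IsCoupling π₂ ν ρ) :
    ∃ γ : Measure ((Rd d × Rd d) × Rd d), γ.map Prod.fst = π₁ ∧
      γ.map (fun z => (z.1.2, z.2)) = π₂ := by
  refine ⟨π₁ ⊗ₘ (π₂.condKernel.comap Prod.snd measurable_snd), ?_, ?_⟩
  · exact Measure.fst_compProd _ _
  · conv_rhs => rw [← π₂.disintegrate π₂.condKernel]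
    ext s hs
    rw [Measure.map_apply (by fun_prop) hs, Measure.compProd_apply (by measurability),
      Measure.compProd_apply hs, show π₂.fst = π₁.map Prod.snd from h₂.1.trans h₁.2.symm,
      lintegral_map (Kernel.measurable_kernel_prodMk_left hs) measurable_snd]
    rfl

lemma IsCoupling.isProbabilityMeasure {d : ℕ} {π : Measure (Rd d × Rd d)} {μ ν : Measure (Rd d)}
    [IsProbabilityMeasure μ] (h : IsCoupling π μ ν) : IsProbabilityMeasure π := by
  have : IsProbabilityMeasure (π.map Prod.fst) := h.1 ▸ inferInstance
  exact Measure.isProbabilityMeasure_of_map Prod.fst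

lemma Wp_triangle {d : ℕ} {p : ℝ} (hp : 1 ≤ p) {μ ν ρ : Measure (Rd d)}
    [IsProbabilityMeasure μ] [IsProbabilityMeasure ν] [IsProbabilityMeasure ρ]
    (hμ : HasFiniteMoment p μ) (hν : HasFiniteMoment p ν) (hρ : HasFiniteMoment p ρ) :
    Wp p μ ρ ≤ Wp p μ ν + Wp p ν ρ := by
  rw [← sub_le_iff_le_add]
  refine le_Wp fun π₁ h₁ => ?_
  rw [sub_le_comm]
  refine le_Wp fun π₂ h₂ => ?_
  rw [sub_le_iff_le_add']
  have := h₁.isProbabilityMeasure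
  have := h₂.isProbabilityMeasure
  obtain ⟨γ, hγ₁, hγ₂⟩ := exists_gluing h₁ h₂
  have hγ : IsCoupling (γ.map (fun z => (z.1.1, z.2))) μ ρ := by
    refine ⟨?_, ?_⟩
    · rw [← h₁.1, ← hγ₁, Measure.map_map (by fun_prop) (by fun_prop),
        Measure.map_map (by fun_prop) (by fun_prop)]
      rfl
    · rw [← h₂.2, ← hγ₂, Measure.map_map (by fun_prop) (by fun_prop),
        Measure.map_map (by fun_prop) (by fun_prop)]
      rfl
  refine (Wp_le hγ).trans ?_
  have e₁ : MeasurePreserving Prod.fst γ π₁ := ⟨measurable_fst, hγ₁⟩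
  have e₂ : MeasurePreserving (fun z => (z.1.2, z.2)) γ π₂ := ⟨by fun_prop, hγ₂⟩
  have e₃ : MeasurePreserving (fun z => (z.1.1, z.2)) γ (γ.map (fun z => (z.1.1, z.2))) :=
    ⟨by fun_prop, rfl⟩
  have m₁ := h₁.memLp_sub hp hμ hν
  have m₂ := h₂.memLp_sub hp hν hρ
  have m₃ := hγ.memLp_sub hp hμ hρ
  rw [integral_rpow_norm_eq_toReal_eLpNorm hp m₁, integral_rpow_norm_eq_toReal_eLpNorm hp m₂,
    integral_rpow_norm_eq_toReal_eLpNorm hp m₃, ← ENNReal.toReal_add m₁.2.ne m₂.2.ne]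
  refine ENNReal.toReal_mono (ENNReal.add_ne_top.2 ⟨m₁.2.ne, m₂.2.ne⟩) ?_
  rw [← eLpNorm_comp_measurePreserving m₁.1 e₁, ← eLpNorm_comp_measurePreserving m₂.1 e₂,
    ← eLpNorm_comp_measurePreserving m₃.1 e₃]
  refine le_trans (le_of_eq ?_) (eLpNorm_add_le (m₁.comp_measurePreserving e₁).1
    (m₂.comp_measurePreserving e₂).1 (by simpa using hp))
  congr 1
  ext1 z
  simp

lemma abs_Wp_sub_Wp_le {d : ℕ} {p : ℝ} (hp : 1 ≤ p) {μ ν ν' : Measure (Rd d)}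
    [IsProbabilityMeasure μ] [IsProbabilityMeasure ν] [IsProbabilityMeasure ν']
    (hμ : HasFiniteMoment p μ) (hν : HasFiniteMoment p ν) (hν' : HasFiniteMoment p ν') :
    |Wp p μ ν - Wp p μ ν'| ≤ Wp p ν ν' := by
  have h₁ := Wp_triangle hp hμ hν hν'
  have h₂ := Wp_triangle hp hμ hν' hν
  rw [Wp_comm p ν' ν] at h₂
  exact abs_sub_le_iff.2 ⟨by linarith, by linarith⟩

lemma hasFiniteMoment_of_isBounded {d : ℕ} {p : ℝ} (hp : 1 ≤ p) {Y : Set (Rd d)}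
    (hY : Bornology.IsBounded Y) {ρ : Measure (Rd d)} [IsFiniteMeasure ρ] (h : ∀ᵐ y ∂ρ, y ∈ Y) :
    HasFiniteMoment p ρ := by
  obtain ⟨C, hC⟩ := hY.exists_norm_le
  refine Integrable.of_bound (by fun_prop (disch := linarith)) (C ^ p) ?_
  filter_upwards [h] with y hy
  rw [Real.norm_of_nonneg (by positivity)]
  exact Real.rpow_le_rpow (norm_nonneg _) (hC y hy) (by linarith)

lemma abs_measureReal_sub_le_tvDist {α : Type*} [MeasurableSpace α] (μ ν : Measure α) [IsProbabilityMeasure μ]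
    [IsProbabilityMeasure ν] {s : Set α} (hs : MeasurableSet s) :
    |μ.real s - ν.real s| ≤ tvDist μ ν := by
  refine le_csSup ⟨1, ?_⟩ ⟨s, hs, rfl⟩
  rintro _ ⟨A, -, rfl⟩
  exact abs_sub_le_of_nonneg_of_le measureReal_nonneg measureReal_le_one measureReal_nonneg
    measureReal_le_one

/-- Two probability measures admit a coupling whose mass off the diagonal is at most their total
variation distance. -/
lemma exists_isCoupling_offDiag_le_tvDist {d : ℕ} (ν ν' : Measure (Rd d)) [IsProbabilityMeasure ν]
    [IsProbabilityMeasure ν'] :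
    ∃ π, IsCoupling π ν ν' ∧ π.real {z | z.1 ≠ z.2} ≤ tvDist ν ν' := by
  obtain ⟨s, hs, h₁, h₂⟩ := hahn_decomposition ν ν'
  have le₁ : ν'.restrict s ≤ ν.restrict s := by
    refine Measure.le_iff.2 fun t ht => ?_
    rw [Measure.restrict_apply ht, Measure.restrict_apply ht]
    exact h₁ _ (ht.inter hs) inter_subset_right
  have le₂ : ν.restrict sᶜ ≤ ν'.restrict sᶜ := by
    refine Measure.le_iff.2 fun t ht => ?_
    rw [Measure.restrict_apply ht, Measure.restrict_apply ht]
    exact h₂ _ (ht.inter hs.compl) inter_subset_right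
  set γ := ν'.restrict s + ν.restrict sᶜ with hγ
  set α := ν.restrict s - ν'.restrict s with hα
  set β := ν'.restrict sᶜ - ν.restrict sᶜ with hβ
  have hαγ : γ + α = ν := by
    rw [hγ, add_right_comm, add_comm (ν'.restrict s), Measure.sub_add_cancel_of_le le₁,
      Measure.restrict_add_restrict_compl hs]
  have hβγ : γ + β = ν' := by
    rw [hγ, add_assoc, add_comm (ν.restrict sᶜ), Measure.sub_add_cancel_of_le le₂,
      Measure.restrict_add_restrict_compl hs]
  have hfγ : γ univ ≠ ⊤ := measure_ne_top _ _
  have hmass : α univ = β univ := by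
    have e₁ : γ univ + α univ = 1 := by
      rw [← Measure.add_apply, hαγ, measure_univ]
    have e₂ : γ univ + β univ = 1 := by
      rw [← Measure.add_apply, hβγ, measure_univ]
    exact (ENNReal.add_right_inj hfγ).1 (e₁.trans e₂.symm)
  have hαtv : (α univ).toReal ≤ tvDist ν ν' := by
    refine le_trans ?_ (abs_measureReal_sub_le_tvDist ν ν' hs)
    rw [hα, Measure.sub_apply MeasurableSet.univ le₁, Measure.restrict_apply_univ,
      Measure.restrict_apply_univ,
      ENNReal.toReal_sub_of_le (h₁ s hs subset_rfl) (measure_ne_top _ _)]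
    exact le_abs_self _
  have hdiag : Measurable fun x : Rd d => (x, x) := by fun_prop
  have hcancel : (α univ)⁻¹ • α univ • α = α ∧ (α univ)⁻¹ • α univ • β = β := by
    rcases eq_or_ne (α univ) 0 with h0 | h0
    · have hα0 : α = 0 := Measure.measure_univ_eq_zero.1 h0
      have hβ0 : β = 0 := Measure.measure_univ_eq_zero.1 (hmass ▸ h0)
      constructor
      · rw [hα0]; simp
      · rw [hβ0]; simp
    · simp only [smul_smul, ENNReal.inv_mul_cancel h0 (measure_ne_top _ _), one_smul, and_self]
  refine ⟨γ.map (fun x => (x, x)) + (α univ)⁻¹ • α.prod β, ⟨?_, ?_⟩, ?_⟩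
  · rw [Measure.map_add _ _ measurable_fst, Measure.map_map measurable_fst hdiag,
      Measure.map_smul, Measure.map_fst_prod, ← hmass, hcancel.1]
    exact (congrArg (· + α) Measure.map_id).trans hαγ
  · rw [Measure.map_add _ _ measurable_snd, Measure.map_map measurable_snd hdiag,
      Measure.map_smul, Measure.map_snd_prod, hcancel.2]
    exact (congrArg (· + β) Measure.map_id).trans hβγ
  · refine le_trans (ENNReal.toReal_mono (measure_ne_top _ _) ?_) hαtv
    have hm : MeasurableSet {z : Rd d × Rd d | z.1 ≠ z.2} :=
      (measurableSet_eq_fun measurable_fst measurable_snd).compl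
    rw [Measure.add_apply, Measure.map_apply hdiag hm, Measure.smul_apply]
    simp only [preimage_ofPred_eq, ne_eq, not_true_eq_false, ofPred_false, measure_empty, zero_add,
      smul_eq_mul]
    calc (α univ)⁻¹ * α.prod β {z | ¬ z.1 = z.2}
        ≤ (α univ)⁻¹ * α.prod β univ := by gcongr; exact subset_univ _
      _ = (α univ)⁻¹ * (α univ * α univ) := by
          rw [← univ_prod_univ, Measure.prod_prod, ← hmass]
      _ ≤ α univ := by
          rw [← mul_assoc]
          exact mul_le_of_le_one_left' (ENNReal.inv_mul_le_one _)

lemma Wp_le_diam_mul_tvDist {d : ℕ} {p : ℝ} (hp : 1 ≤ p) {Y : Set (Rd d)}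
    (hYbdd : Bornology.IsBounded Y) {ν ν' : Measure (Rd d)} [IsProbabilityMeasure ν]
    [IsProbabilityMeasure ν'] (hν : ∀ᵐ y ∂ν, y ∈ Y) (hν' : ∀ᵐ y ∂ν', y ∈ Y) :
    Wp p ν ν' ≤ Metric.diam Y * tvDist ν ν' ^ (1 / p) := by
  have h0 : 0 < p := by linarith
  obtain ⟨π, hπ, htv⟩ := exists_isCoupling_offDiag_le_tvDist ν ν'
  have := hπ.isProbabilityMeasure
  have hD : 0 ≤ Metric.diam Y := Metric.diam_nonneg
  have hm : MeasurableSet {z : Rd d × Rd d | z.1 ≠ z.2} :=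
    (measurableSet_eq_fun measurable_fst measurable_snd).compl
  have hint : ∫ z, ‖z.1 - z.2‖ ^ p ∂π ≤ Metric.diam Y ^ p * tvDist ν ν' := by
    calc ∫ z, ‖z.1 - z.2‖ ^ p ∂π
        ≤ ∫ z, {z : Rd d × Rd d | z.1 ≠ z.2}.indicator (fun _ => Metric.diam Y ^ p) z ∂π := by
          refine integral_mono_of_nonneg (ae_of_all _ fun z => by positivity)
            ((integrable_const _).indicator hm) ?_
          filter_upwards [ae_of_ae_map measurable_fst.aemeasurable (hπ.1 ▸ hν),
            ae_of_ae_map measurable_snd.aemeasurable (hπ.2 ▸ hν')] with z h₁ h₂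
          by_cases hz : z.1 = z.2
          · simp [hz, h0.ne']
          · rw [indicator_of_mem (show z ∈ {z : Rd d × Rd d | z.1 ≠ z.2} from hz), ← dist_eq_norm]
            exact Real.rpow_le_rpow dist_nonneg (Metric.dist_le_diam_of_mem hYbdd h₁ h₂) h0.le
      _ = Metric.diam Y ^ p * π.real {z | z.1 ≠ z.2} := by
          rw [integral_indicator_const _ hm, smul_eq_mul, mul_comm]
      _ ≤ Metric.diam Y ^ p * tvDist ν ν' := by gcongr
  calc Wp p ν ν' ≤ (∫ z, ‖z.1 - z.2‖ ^ p ∂π) ^ (1 / p) := Wp_le hπ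
    _ ≤ (Metric.diam Y ^ p * tvDist ν ν') ^ (1 / p) := by gcongr
    _ = Metric.diam Y * tvDist ν ν' ^ (1 / p) := by
        rw [Real.mul_rpow (by positivity) (measureReal_nonneg.trans htv), one_div,
          Real.rpow_rpow_inv hD h0.ne']

/-- Stability of `E_p` in the target measure:
`|E_p(κ;μ,ν) − E_p(κ;μ,ν')| ≤ 2 W_p(ν,ν') ≤ 2 diam(Y) ‖ν−ν'‖_TV^{1/p}`. -/
theorem ep_nu_stability {d : ℕ} (hd : 1 ≤ d) {p : ℝ} (hp : 1 ≤ p)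
    (X Y : Set (Rd d)) (hX : MeasurableSet X) (hY : MeasurableSet Y)
    (hYbdd : Bornology.IsBounded Y)
    (μ ν ν' : Measure (Rd d)) [IsProbabilityMeasure μ] [IsProbabilityMeasure ν]
    [IsProbabilityMeasure ν']
    (hμX : μ X = 1) (hνY : ν Y = 1) (hν'Y : ν' Y = 1)
    (hμmom : HasFiniteMoment p μ) (hνmom : HasFiniteMoment p ν) (hν'mom : HasFiniteMoment p ν')
    (κ : Kernel (Rd d) (Rd d)) [IsMarkovKernel κ] (hκY : ∀ x ∈ X, κ x Y = 1) :
    |Ep p κ μ ν - Ep p κ μ ν'| ≤ 2 * Wp p ν ν' ∧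
      2 * Wp p ν ν' ≤ 2 * Metric.diam Y * tvDist ν ν' ^ (1 / p) := by
  have hνae : ∀ᵐ y ∂ν, y ∈ Y := (prob_compl_eq_zero_iff hY).2 hνY
  have hν'ae : ∀ᵐ y ∂ν', y ∈ Y := (prob_compl_eq_zero_iff hY).2 hν'Y
  have hXae : ∀ᵐ x ∂μ, x ∈ X := (prob_compl_eq_zero_iff hX).2 hμX
  have hprob : IsProbabilityMeasure (kpush κ μ) := by
    unfold kpush; infer_instance
  have hpush : ∀ᵐ y ∂(kpush κ μ), y ∈ Y := by
    rw [ae_iff, ← compl_def, kpush, Measure.bind_apply hY.compl κ.aemeasurable]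
    refine lintegral_eq_zero_of_ae_eq_zero ?_
    filter_upwards [hXae] with x hx
    exact (prob_compl_eq_zero_iff hY).2 (hκY x hx)
  refine ⟨?_, ?_⟩
  · have h₁ := abs_Wp_sub_Wp_le hp hμmom hνmom hν'mom
    have h₂ := abs_Wp_sub_Wp_le hp (hasFiniteMoment_of_isBounded hp hYbdd hpush) hνmom hν'mom
    have h₃ := abs_max_sub_max_le_abs (kernelCost p κ μ - Wp p μ ν)
      (kernelCost p κ μ - Wp p μ ν') 0
    rw [sub_sub_sub_cancel_left, abs_sub_comm (Wp p μ ν')] at h₃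
    unfold Ep
    rw [add_sub_add_comm]
    refine (abs_add_le _ _).trans ?_
    linarith
  · rw [mul_assoc]
    exact mul_le_mul_of_nonneg_left (Wp_le_diam_mul_tvDist hp hYbdd hνae hν'ae) zero_le_two
end
end

section
/- There is an absolute constant C such that the following holds. Fix μ, μ' ∈ P(X) and ν ∈ P(Y), all with finite p-th moments and Y bounded, and a Markov kernel κ from X to Y. Setting ε = ‖μ − μ'‖_TV, one has E_p(κ;μ',ν) ≤ C ( E_p(κ;μ,ν) + E_p(κ;μ,ν)^{1/p} W_p(μ,ν)^{(p−1)/p} + diam(Y) ε^{1/p} ). In particular, for p = 1, E_1(κ;μ',ν) ≤ C ( E_1(κ;μ,ν) + diam(Y) ε ). -/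
open MeasureTheory ProbabilityTheory Set

noncomputable section

open scoped ENNReal

/-- The `L^p` cost of a plan `π`, with values in `[0, ∞]`. -/
def planCost {d : ℕ} (p : ℝ) (π : Measure (Rd d × Rd d)) : ℝ≥0∞ :=
  eLpNorm' (fun z : Rd d × Rd d => z.1 - z.2) p π

/-- The `p`-Wasserstein distance with values in `[0, ∞]`. -/
def eWp {d : ℕ} (p : ℝ) (μ ν : Measure (Rd d)) : ℝ≥0∞ :=
  ⨅ π : {π : Measure (Rd d × Rd d) // IsCoupling π μ ν}, planCost p π.1

lemma eWp_le_planCost {d : ℕ} {p : ℝ} {μ ν : Measure (Rd d)} {π : Measure (Rd d × Rd d)}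
    (h : IsCoupling π μ ν) : eWp p μ ν ≤ planCost p π :=
  iInf_le (fun π : {π : Measure (Rd d × Rd d) // IsCoupling π μ ν} => planCost p π.1) ⟨π, h⟩

lemma planCost_map {d : ℕ} {p : ℝ} {Ω : Type*} [MeasurableSpace Ω] {P : Measure Ω}
    {f g : Ω → Rd d} (hf : Measurable f) (hg : Measurable g) :
    planCost p (P.map fun ω => (f ω, g ω)) = eLpNorm' (fun ω => f ω - g ω) p P := by
  simp only [planCost, eLpNorm']
  rw [lintegral_map (by fun_prop) (by fun_prop)]

lemma eLpNorm'_sub_le_add {d : ℕ} {p : ℝ} (hp : 1 ≤ p) {Ω : Type*} [MeasurableSpace Ω]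
    {P : Measure Ω} {f g h : Ω → Rd d} (hf : Measurable f) (hg : Measurable g)
    (hh : Measurable h) :
    eLpNorm' (fun ω => f ω - h ω) p P ≤
      eLpNorm' (fun ω => f ω - g ω) p P + eLpNorm' (fun ω => g ω - h ω) p P := by
  have := eLpNorm'_add_le (μ := P) (f := fun ω => f ω - g ω) (g := fun ω => g ω - h ω)
    (by fun_prop) (by fun_prop) hp
  refine le_trans (le_of_eq ?_) this
  congr 1
  ext1 ω
  simp

lemma eLpNorm'_le_of_ae_mem {d : ℕ} {p : ℝ} (hp : 1 ≤ p) {Ω : Type*} [MeasurableSpace Ω]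
    {P : Measure Ω} {f g : Ω → Rd d} {Y : Set (Rd d)} (hY : Bornology.IsBounded Y)
    (hf : ∀ᵐ ω ∂P, f ω ∈ Y) (hg : ∀ᵐ ω ∂P, g ω ∈ Y) :
    eLpNorm' (fun ω => f ω - g ω) p P ≤
      ENNReal.ofReal (Metric.diam Y) * P univ ^ (1 / p) := by
  have hp0 : 0 < p := by linarith
  have h : ∫⁻ ω, ‖f ω - g ω‖ₑ ^ p ∂P ≤ ENNReal.ofReal (Metric.diam Y) ^ p * P univ := by
    rw [← lintegral_const]
    refine lintegral_mono_ae ?_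
    filter_upwards [hf, hg] with ω h1 h2
    gcongr
    rw [← ofReal_norm, ← dist_eq_norm]
    exact ENNReal.ofReal_le_ofReal (Metric.dist_le_diam_of_mem hY h1 h2)
  calc eLpNorm' (fun ω => f ω - g ω) p P
      ≤ (ENNReal.ofReal (Metric.diam Y) ^ p * P univ) ^ (1 / p) := by
        unfold eLpNorm'; gcongr
    _ = _ := by
        rw [ENNReal.mul_rpow_of_nonneg _ _ (by positivity), ← ENNReal.rpow_mul,
          mul_one_div_cancel hp0.ne', ENNReal.rpow_one]

lemma compProd_comap_map {α β γ : Type*} [MeasurableSpace α] [MeasurableSpace β]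
    [MeasurableSpace γ] (π : Measure α) [SFinite π] (κ : Kernel β γ) [IsMarkovKernel κ]
    {f : α → β} (hf : Measurable f) :
    (π ⊗ₘ κ.comap f hf).map (Prod.map f id) = π.map f ⊗ₘ κ := by
  ext s hs
  have hm : Measurable (Prod.map f (id : γ → γ)) := by fun_prop
  rw [Measure.map_apply hm hs, Measure.compProd_apply (hm hs), Measure.compProd_apply hs,
    lintegral_map (Kernel.measurable_kernel_prodMk_left hs) hf]
  rfl

lemma IsCoupling.isFiniteMeasure {d : ℕ} {π : Measure (Rd d × Rd d)} {μ ν : Measure (Rd d)}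
    [IsFiniteMeasure μ] (h : IsCoupling π μ ν) : IsFiniteMeasure π := by
  refine ⟨?_⟩
  have := congrArg (fun m => m univ) h.1
  simp only [Measure.map_apply measurable_fst MeasurableSet.univ, preimage_univ] at this
  rw [this]
  exact measure_lt_top _ _

lemma IsCoupling.compProd {d : ℕ} (μ : Measure (Rd d)) [SFinite μ] (κ : Kernel (Rd d) (Rd d))
    [IsMarkovKernel κ] : IsCoupling (μ ⊗ₘ κ) μ (κ ∘ₘ μ) :=
  ⟨Measure.fst_compProd μ κ, Measure.snd_compProd μ κ⟩

lemma IsCoupling.exists_kernel {d : ℕ} {π : Measure (Rd d × Rd d)} {μ ν : Measure (Rd d)}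
    [IsFiniteMeasure μ] (h : IsCoupling π μ ν) :
    ∃ K : Kernel (Rd d) (Rd d), IsMarkovKernel K ∧ μ ⊗ₘ K = π ∧ K ∘ₘ μ = ν := by
  have := h.isFiniteMeasure
  have h1 : μ ⊗ₘ π.condKernel = π := by
    have h2 : π.fst = μ := h.1
    rw [← h2]
    exact π.disintegrate π.condKernel
  refine ⟨π.condKernel, inferInstance, h1, ?_⟩
  rw [← Measure.snd_compProd, h1]
  exact h.2

lemma eWp_le_planCost_add_planCost {d : ℕ} {p : ℝ} (hp : 1 ≤ p) {μ ν ρ : Measure (Rd d)}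
    [IsFiniteMeasure μ] [IsFiniteMeasure ν] {π₁ π₂ : Measure (Rd d × Rd d)}
    (h₁ : IsCoupling π₁ μ ν) (h₂ : IsCoupling π₂ ν ρ) :
    eWp p μ ρ ≤ planCost p π₁ + planCost p π₂ := by
  have := h₁.isFiniteMeasure
  obtain ⟨L, hL, hL₂, -⟩ := h₂.exists_kernel
  set P := π₁ ⊗ₘ L.comap Prod.snd measurable_snd with hP
  have e₁ : P.map (fun z => (z.1.1, z.1.2)) = π₁ := Measure.fst_compProd _ _
  have e₂ : P.map (fun z => (z.1.2, z.2)) = π₂ := by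
    rw [← hL₂, ← h₁.2]
    exact compProd_comap_map π₁ L measurable_snd
  have hc : IsCoupling (P.map fun z => (z.1.1, z.2)) μ ρ := by
    constructor
    · rw [Measure.map_map (by fun_prop) (by fun_prop), ← h₁.1, ← e₁,
        Measure.map_map (by fun_prop) (by fun_prop)]
      rfl
    · rw [Measure.map_map (by fun_prop) (by fun_prop), ← h₂.2, ← e₂,
        Measure.map_map (by fun_prop) (by fun_prop)]
      rfl
  refine (eWp_le_planCost hc).trans ?_
  rw [← e₁, ← e₂, planCost_map (by fun_prop) (by fun_prop),
    planCost_map (by fun_prop) (by fun_prop), planCost_map (by fun_prop) (by fun_prop)]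
  exact eLpNorm'_sub_le_add hp (by fun_prop) (by fun_prop) (by fun_prop)

lemma eWp_triangle {d : ℕ} {p : ℝ} (hp : 1 ≤ p) (μ ν ρ : Measure (Rd d))
    [IsFiniteMeasure μ] [IsFiniteMeasure ν] :
    eWp p μ ρ ≤ eWp p μ ν + eWp p ν ρ := by
  conv_rhs => rw [eWp, eWp, ENNReal.iInf_add]
  refine le_iInf fun π₁ => ?_
  rw [ENNReal.add_iInf]
  exact le_iInf fun π₂ => eWp_le_planCost_add_planCost hp π₁.2 π₂.2

lemma eWp_le_swap {d : ℕ} (p : ℝ) (μ ν : Measure (Rd d)) : eWp p μ ν ≤ eWp p ν μ := by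
  refine le_iInf fun ⟨π, h⟩ => ?_
  have hc : IsCoupling (π.map fun z => (z.2, z.1)) μ ν := by
    constructor
    · rw [Measure.map_map (by fun_prop) (by fun_prop), ← h.2]
      rfl
    · rw [Measure.map_map (by fun_prop) (by fun_prop), ← h.1]
      rfl
  refine (eWp_le_planCost hc).trans (le_of_eq ?_)
  rw [planCost_map (by fun_prop) (by fun_prop)]
  simp only [planCost, eLpNorm']
  congr 2
  ext z
  rw [← enorm_neg, neg_sub]

lemma planCost_rpow_add {d : ℕ} {p : ℝ} (hp : 1 ≤ p) (π₁ π₂ : Measure (Rd d × Rd d)) :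
    planCost p (π₁ + π₂) ^ p = planCost p π₁ ^ p + planCost p π₂ ^ p := by
  have hp0 : p ≠ 0 := by linarith
  simp only [planCost, eLpNorm', ← ENNReal.rpow_mul, one_div_mul_cancel hp0, ENNReal.rpow_one]
  rw [lintegral_add_measure]

lemma IsCoupling.add {d : ℕ} {π₁ π₂ : Measure (Rd d × Rd d)} {μ₁ μ₂ ν₁ ν₂ : Measure (Rd d)}
    (h₁ : IsCoupling π₁ μ₁ ν₁) (h₂ : IsCoupling π₂ μ₂ ν₂) :
    IsCoupling (π₁ + π₂) (μ₁ + μ₂) (ν₁ + ν₂) := by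
  constructor
  · rw [Measure.map_add _ _ measurable_fst, h₁.1, h₂.1]
  · rw [Measure.map_add _ _ measurable_snd, h₁.2, h₂.2]

lemma exists_common_part {α : Type*} [MeasurableSpace α] (σ τ : Measure α) [IsFiniteMeasure σ]
    [IsFiniteMeasure τ] :
    ∃ m a b : Measure α, ∃ s : Set α, MeasurableSet s ∧ σ = m + a ∧ τ = m + b ∧
      a univ + τ s = σ s := by
  obtain ⟨s, hs, h₁, h₂⟩ := hahn_decomposition σ τ
  have l₁ : τ.restrict s ≤ σ.restrict s := by
    refine Measure.le_iff.2 fun t ht => ?_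
    rw [Measure.restrict_apply ht, Measure.restrict_apply ht]
    exact h₁ _ (ht.inter hs) inter_subset_right
  have l₂ : σ.restrict sᶜ ≤ τ.restrict sᶜ := by
    refine Measure.le_iff.2 fun t ht => ?_
    rw [Measure.restrict_apply ht, Measure.restrict_apply ht]
    exact h₂ _ (ht.inter hs.compl) inter_subset_right
  have e₁ := Measure.sub_add_cancel_of_le l₁
  have e₂ := Measure.sub_add_cancel_of_le l₂
  refine ⟨τ.restrict s + σ.restrict sᶜ, σ.restrict s - τ.restrict s,
    τ.restrict sᶜ - σ.restrict sᶜ, s, hs, ?_, ?_, ?_⟩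
  · rw [add_right_comm, add_comm (τ.restrict s), e₁, Measure.restrict_add_restrict_compl hs]
  · rw [add_assoc, add_comm (σ.restrict sᶜ), e₂, Measure.restrict_add_restrict_compl hs]
  · have := congrArg (fun m => m univ) e₁
    simpa using this

lemma eWp_le_of_add_eq_add {d : ℕ} {p : ℝ} (hp : 1 ≤ p) {Y : Set (Rd d)}
    (hY : Bornology.IsBounded Y) {σ τ r₁ r₂ : Measure (Rd d)}
    [IsFiniteMeasure σ] [IsFiniteMeasure τ]
    (hσY : ∀ᵐ y ∂σ, y ∈ Y) (hτY : ∀ᵐ y ∂τ, y ∈ Y) (hmass : σ univ = τ univ)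
    (h : σ + r₁ = τ + r₂) :
    eWp p σ τ ≤ ENNReal.ofReal (Metric.diam Y) * r₂ univ ^ (1 / p) := by
  have hp0 : 0 < p := by linarith
  obtain ⟨m, a, b, s, hs, rfl, rfl, ha⟩ := exists_common_part σ τ
  have hma : IsFiniteMeasure m := isFiniteMeasure_of_le (m + a) (Measure.le_add_right le_rfl)
  have haf : IsFiniteMeasure a := isFiniteMeasure_of_le (m + a) (Measure.le_add_left le_rfl)
  have hbf : IsFiniteMeasure b := isFiniteMeasure_of_le (m + b) (Measure.le_add_left le_rfl)
  have hab : a univ = b univ := by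
    simpa [ENNReal.add_right_inj (measure_ne_top m univ)] using hmass
  have har : a univ ≤ r₂ univ := by
    have h1 := congrArg (fun m => m s) h
    simp only [Measure.add_apply] at h1 ha
    have h2 : a univ + (m s + b s) ≤ r₂ s + (m s + b s) := by
      rw [ha, add_comm (r₂ s), ← h1]
      exact le_self_add
    exact ((ENNReal.add_le_add_iff_right (by finiteness)).1 h2).trans (measure_mono (subset_univ _))
  have hay : ∀ᵐ y ∂a, y ∈ Y := (Measure.absolutelyContinuous_of_le
    (Measure.le_add_left le_rfl)).ae_le hσY
  have hby : ∀ᵐ y ∂b, y ∈ Y := (Measure.absolutelyContinuous_of_le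
    (Measure.le_add_left le_rfl)).ae_le hτY
  set Q := (a univ)⁻¹ • a.prod b with hQ
  have hcQ : IsCoupling Q a b := by
    by_cases h0 : a univ = 0
    · have ha0 : a = 0 := Measure.measure_univ_eq_zero.1 h0
      have hb0 : b = 0 := Measure.measure_univ_eq_zero.1 (hab ▸ h0)
      simp [IsCoupling, hQ, ha0, hb0]
    · constructor
      · rw [hQ, Measure.map_smul, Measure.map_fst_prod, ← hab, smul_smul,
          ENNReal.inv_mul_cancel h0 (by finiteness), one_smul]
      · rw [hQ, Measure.map_smul, Measure.map_snd_prod, smul_smul,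
          ENNReal.inv_mul_cancel h0 (by finiteness), one_smul]
  have hQuniv : Q univ = a univ := by
    conv_rhs => rw [← hcQ.1]
    simp [Measure.map_apply measurable_fst MeasurableSet.univ]
  have hcm : IsCoupling (m.map fun x => (x, x)) m m := by
    constructor <;>
    · rw [Measure.map_map (by fun_prop) (by fun_prop)]
      exact Measure.map_id
  have hm0 : planCost p (m.map fun x => (x, x)) = 0 := by
    rw [planCost_map (f := fun x => x) (g := fun x => x) measurable_id measurable_id]
    simp [eLpNorm', hp0]
  refine (eWp_le_planCost (hcm.add hcQ)).trans ?_
  have hcost : planCost p ((m.map fun x => (x, x)) + Q) = planCost p Q := by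
    have := planCost_rpow_add hp (m.map fun x => (x, x)) Q
    rw [hm0, ENNReal.zero_rpow_of_pos hp0, zero_add] at this
    exact ENNReal.rpow_left_injective hp0.ne' this
  rw [hcost]
  refine (eLpNorm'_le_of_ae_mem hp hY (f := Prod.fst) (g := Prod.snd) ?_ ?_).trans ?_
  · exact ae_of_ae_map measurable_fst.aemeasurable (hcQ.1.symm ▸ hay)
  · exact ae_of_ae_map measurable_snd.aemeasurable (hcQ.2.symm ▸ hby)
  · rw [hQuniv]
    gcongr

lemma planCost_compProd_le {d : ℕ} {p : ℝ} (hp : 1 ≤ p) {Y : Set (Rd d)}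
    (hY : Bornology.IsBounded Y)
    (β : Measure (Rd d)) [IsFiniteMeasure β] (κ K : Kernel (Rd d) (Rd d)) [IsMarkovKernel κ]
    [IsMarkovKernel K] (hκ : ∀ᵐ y ∂(κ ∘ₘ β), y ∈ Y) (hK : ∀ᵐ y ∂(K ∘ₘ β), y ∈ Y) :
    planCost p (β ⊗ₘ κ) ≤
      planCost p (β ⊗ₘ K) + ENNReal.ofReal (Metric.diam Y) * β univ ^ (1 / p) := by
  set P := (β ⊗ₘ K) ⊗ₘ κ.comap Prod.fst measurable_fst with hP
  have e₁ : P.map (fun z => (z.1.1, z.1.2)) = β ⊗ₘ K := Measure.fst_compProd _ _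
  have e₂ : P.map (fun z => (z.1.1, z.2)) = β ⊗ₘ κ := by
    have h : (β ⊗ₘ K).map Prod.fst = β := Measure.fst_compProd _ _
    conv_rhs => rw [← h]
    exact compProd_comap_map _ κ measurable_fst
  have hu : P univ = β univ := by
    rw [hP, Measure.compProd_apply_univ, Measure.compProd_apply_univ]
  have h₁ : ∀ᵐ z ∂P, z.1.2 ∈ Y := by
    rw [← Measure.snd_compProd, ← e₁, Measure.snd,
      Measure.map_map (by fun_prop) (by fun_prop)] at hK
    exact ae_of_ae_map (by fun_prop) hK
  have h₂ : ∀ᵐ z ∂P, z.2 ∈ Y := by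
    rw [← Measure.snd_compProd, ← e₂, Measure.snd,
      Measure.map_map (by fun_prop) (by fun_prop)] at hκ
    exact ae_of_ae_map (by fun_prop) hκ
  rw [← hu, ← e₁, ← e₂, planCost_map (by fun_prop) (by fun_prop),
    planCost_map (by fun_prop) (by fun_prop)]
  refine (eLpNorm'_sub_le_add (g := fun z => z.1.2) hp (by fun_prop) (by fun_prop)
    (by fun_prop)).trans ?_
  gcongr
  exact eLpNorm'_le_of_ae_mem hp hY h₁ h₂

lemma rpow_sub_rpow_le {p x y : ℝ} (hp : 1 ≤ p) (hx : 0 ≤ x) (hxy : x ≤ y) :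
    y ^ p - x ^ p ≤ p * (y - x) * y ^ (p - 1) := by
  rcases hx.eq_or_lt with rfl | hx0
  · rcases hxy.eq_or_lt with rfl | hy
    · simp [Real.zero_rpow (by linarith : p ≠ 0)]
    · rw [Real.zero_rpow (by linarith), sub_zero, sub_zero, mul_assoc,
        ← Real.rpow_one_add' hy.le (by linarith), add_sub_cancel]
      nlinarith [Real.rpow_nonneg hy.le p]
  · have hy : 0 < y := hx0.trans_le hxy
    have h := one_add_mul_self_le_rpow_one_add (s := x / y - 1)
      (by linarith [div_nonneg hx hy.le]) hp
    rw [add_sub_cancel, Real.div_rpow hx hy.le, le_div_iff₀ (by positivity)] at h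
    have h2 : y ^ p = y * y ^ (p - 1) := by
      rw [← Real.rpow_one_add' hy.le (by linarith), add_sub_cancel]
    have h3 : (1 + p * (x / y - 1)) * y ^ p = y ^ p + p * (x - y) * y ^ (p - 1) := by
      rw [h2]; field_simp
    linarith

lemma rpow_add_le_add_rpow {x y q : ℝ} (hx : 0 ≤ x) (hy : 0 ≤ y) (hq : 0 ≤ q) (hq1 : q ≤ 1) :
    (x + y) ^ q ≤ x ^ q + y ^ q := by
  lift x to NNReal using hx
  lift y to NNReal using hy
  exact_mod_cast NNReal.rpow_add_le_add_rpow x y hq hq1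

lemma le_add_of_rpow_add_le {p a t b v w e : ℝ} (hp : 1 ≤ p) (ha : 0 ≤ a) (ht : 0 ≤ t)
    (hv : 0 ≤ v) (hw : 0 ≤ w) (he : 0 ≤ e) (h₁ : a ^ p + b ≤ (v + 2 * e) ^ p)
    (h₂ : v ^ p ≤ t ^ p + b) (h₃ : v ≤ w + e) :
    a ≤ t + (12 * e + 4 * (e ^ (1 / p) * w ^ ((p - 1) / p))) := by
  have hp0 : 0 < p := by linarith
  set q := (p - 1) / p with hq
  have hq0 : 0 ≤ q := div_nonneg (by linarith) hp0.le
  have hq1 : q ≤ 1 := by rw [hq, div_le_one hp0]; linarith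
  have hpq : 1 / p + q = 1 := by rw [hq]; field_simp; ring
  set S := v + 2 * e with hS
  have hS0 : 0 ≤ S := by positivity
  have h4 := rpow_sub_rpow_le (x := v) (y := S) hp hv (by linarith)
  have h5 : a ^ p ≤ t ^ p + 2 * p * e * S ^ (p - 1) := by
    have : p * (S - v) * S ^ (p - 1) = 2 * p * e * S ^ (p - 1) := by rw [hS]; ring
    linarith
  have h6 : a ≤ t + (2 * p * e * S ^ (p - 1)) ^ (1 / p) := by
    have h7 := Real.rpow_le_rpow (by positivity) h5 (by positivity : 0 ≤ 1 / p)
    have h8 := rpow_add_le_add_rpow (x := t ^ p) (y := 2 * p * e * S ^ (p - 1)) (q := 1 / p)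
      (by positivity) (by positivity) (by positivity) (by rw [div_le_one hp0]; exact hp)
    rw [← Real.rpow_mul ha, mul_one_div_cancel hp0.ne', Real.rpow_one] at h7
    rw [← Real.rpow_mul ht, mul_one_div_cancel hp0.ne', Real.rpow_one] at h8
    exact h7.trans h8
  have h9 : (2 * p) ^ (1 / p) ≤ 4 := by
    have h := one_add_mul_self_le_rpow_one_add (s := 3) (by norm_num) hp
    have h' := Real.rpow_le_rpow (by positivity) (by linarith : 2 * p ≤ (1 + 3 : ℝ) ^ p)
      (by positivity : 0 ≤ 1 / p)
    rw [← Real.rpow_mul (by norm_num), mul_one_div_cancel hp0.ne', Real.rpow_one] at h'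
    linarith
  have h10 : (2 * p * e * S ^ (p - 1)) ^ (1 / p) = (2 * p) ^ (1 / p) * (e ^ (1 / p) * S ^ q) := by
    rw [Real.mul_rpow (by positivity) (by positivity), Real.mul_rpow (by positivity) he,
      ← Real.rpow_mul hS0, mul_one_div, mul_assoc]
  have h11 : S ^ q ≤ w ^ q + 3 * e ^ q := by
    calc S ^ q ≤ (w + 3 * e) ^ q := Real.rpow_le_rpow hS0 (by linarith) hq0
      _ ≤ w ^ q + (3 * e) ^ q := rpow_add_le_add_rpow hw (by positivity) hq0 hq1
      _ = w ^ q + 3 ^ q * e ^ q := by rw [Real.mul_rpow (by norm_num) he]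
      _ ≤ w ^ q + 3 * e ^ q := by
        gcongr
        simpa using Real.rpow_le_rpow_of_exponent_le (by norm_num : (1 : ℝ) ≤ 3) hq1
  have h12 : e ^ (1 / p) * e ^ q = e := by
    rw [← Real.rpow_add_of_nonneg he (by positivity) hq0, hpq, Real.rpow_one]
  calc a ≤ t + (2 * p) ^ (1 / p) * (e ^ (1 / p) * S ^ q) := h10 ▸ h6
    _ ≤ t + 4 * (e ^ (1 / p) * (w ^ q + 3 * e ^ q)) := by gcongr
    _ = t + (12 * (e ^ (1 / p) * e ^ q) + 4 * (e ^ (1 / p) * w ^ q)) := by ring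
    _ = _ := by rw [h12]

lemma ennreal_le_add_of_rpow_add_le {p : ℝ} (hp : 1 ≤ p) {a t b v : ℝ≥0∞} {w e : ℝ}
    (hw : 0 ≤ w) (he : 0 ≤ e) (h₁ : a ^ p + b ≤ (v + 2 * ENNReal.ofReal e) ^ p)
    (h₂ : v ^ p ≤ t ^ p + b) (h₃ : v ≤ ENNReal.ofReal w + ENNReal.ofReal e) :
    a ≤ t + ENNReal.ofReal (12 * e + 4 * (e ^ (1 / p) * w ^ ((p - 1) / p))) := by
  have hp0 : 0 < p := by linarith
  rcases eq_or_ne t ⊤ with rfl | ht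
  · simp
  have hv : v ≠ ⊤ := ne_top_of_le_ne_top (by finiteness) h₃
  have hr : (v + 2 * ENNReal.ofReal e) ^ p ≠ ⊤ :=
    ENNReal.rpow_ne_top_of_nonneg hp0.le (by finiteness)
  have hb : b ≠ ⊤ := ne_top_of_le_ne_top hr (le_add_self.trans h₁)
  have ha : a ≠ ⊤ := by
    have := ne_top_of_le_ne_top hr (le_self_add.trans h₁)
    rintro rfl
    simp [hp0] at this
  have hap : a ^ p ≠ ⊤ := ENNReal.rpow_ne_top_of_nonneg hp0.le ha
  have htp : t ^ p ≠ ⊤ := ENNReal.rpow_ne_top_of_nonneg hp0.le ht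
  have r₁ := ENNReal.toReal_mono hr h₁
  have r₂ := ENNReal.toReal_mono (by finiteness) h₂
  have r₃ := ENNReal.toReal_mono (by finiteness) h₃
  rw [ENNReal.toReal_add hap hb, ← ENNReal.toReal_rpow, ← ENNReal.toReal_rpow,
    ENNReal.toReal_add hv (by finiteness), ENNReal.toReal_mul, ENNReal.toReal_ofReal he] at r₁
  rw [ENNReal.toReal_add htp hb, ← ENNReal.toReal_rpow, ← ENNReal.toReal_rpow] at r₂
  rw [ENNReal.toReal_add (by finiteness) (by finiteness), ENNReal.toReal_ofReal he,
    ENNReal.toReal_ofReal hw] at r₃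
  have := le_add_of_rpow_add_le hp ENNReal.toReal_nonneg ENNReal.toReal_nonneg
    ENNReal.toReal_nonneg hw he r₁ r₂ r₃
  rw [← ENNReal.ofReal_toReal ha, ← ENNReal.ofReal_toReal ht,
    ← ENNReal.ofReal_add ENNReal.toReal_nonneg (by positivity)]
  exact ENNReal.ofReal_le_ofReal this

lemma rpow_add_rpow_le_of_le_add {p : ℝ} (hp : 1 ≤ p) {x x₁ x₂ u v r s : ℝ≥0∞}
    {y : ℝ≥0∞} (hx : x ^ p = x₁ ^ p + x₂ ^ p) (hy : y ^ p = u ^ p + v ^ p)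
    (h₁ : x₁ ≤ u + r) (h₂ : x₂ ≤ v + s) : x ≤ y + (r + s) := by
  have hp0 : 0 < p := by linarith
  have root (z : ℝ≥0∞) : (z ^ p) ^ (1 / p) = z := by
    rw [← ENNReal.rpow_mul, mul_one_div_cancel hp0.ne', ENNReal.rpow_one]
  have hM := ENNReal.Lp_add_le (Finset.univ : Finset (Fin 2)) ![u, v] ![r, s] hp
  simp only [Fin.sum_univ_two, Matrix.cons_val_zero, Matrix.cons_val_one] at hM
  calc x = (x₁ ^ p + x₂ ^ p) ^ (1 / p) := by rw [← hx, root]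
    _ ≤ ((u + r) ^ p + (v + s) ^ p) ^ (1 / p) := by gcongr
    _ ≤ y + (r ^ p + s ^ p) ^ (1 / p) := by rwa [← hy, root] at hM
    _ ≤ y + (r + s) := by
      gcongr
      exact ENNReal.rpow_add_rpow_le_add r s hp

lemma eWp_comp_common_part_le {d : ℕ} {p : ℝ} (hp : 1 ≤ p) {Y : Set (Rd d)}
    (hY : Bornology.IsBounded Y) {lam β β' ν : Measure (Rd d)} [IsFiniteMeasure lam]
    [IsFiniteMeasure β] [IsFiniteMeasure β'] (κ K : Kernel (Rd d) (Rd d)) [IsMarkovKernel κ]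
    [IsMarkovKernel K] (hK : K ∘ₘ (lam + β') = ν) (hκ : ∀ᵐ y ∂(κ ∘ₘ (lam + β)), y ∈ Y) :
    eWp p (K ∘ₘ lam) (κ ∘ₘ lam) ≤ eWp p ν (κ ∘ₘ (lam + β)) +
      ENNReal.ofReal (Metric.diam Y) * β univ ^ (1 / p) := by
  have hν : IsFiniteMeasure ν := hK ▸ inferInstance
  conv_rhs => rw [eWp, ENNReal.iInf_add]
  refine le_iInf fun ⟨π, hπ⟩ => ?_
  obtain ⟨L, hL, rfl, hLν⟩ := hπ.exists_kernel
  have hκlam : κ ∘ₘ lam ≤ κ ∘ₘ (lam + β) := by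
    rw [Measure.comp_add]; exact Measure.le_add_right le_rfl
  have hsum : L ∘ₘ (K ∘ₘ lam) + L ∘ₘ (K ∘ₘ β') = κ ∘ₘ lam + κ ∘ₘ β := by
    rw [← Measure.comp_add, ← Measure.comp_add, ← Measure.comp_add, hK, hLν]
  have hLlam : L ∘ₘ (K ∘ₘ lam) ≤ κ ∘ₘ (lam + β) := by
    rw [Measure.comp_add, ← hsum]; exact Measure.le_add_right le_rfl
  have mass (M : Kernel (Rd d) (Rd d)) [IsMarkovKernel M] (ρ : Measure (Rd d)) :
      (M ∘ₘ ρ) univ = ρ univ := by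
    rw [Measure.bind_apply MeasurableSet.univ M.aemeasurable]; simp
  have h₁ := eWp_le_of_add_eq_add hp hY (σ := L ∘ₘ (K ∘ₘ lam)) (τ := κ ∘ₘ lam)
    (r₁ := L ∘ₘ (K ∘ₘ β')) (r₂ := κ ∘ₘ β)
    ((Measure.absolutelyContinuous_of_le hLlam).ae_le hκ)
    ((Measure.absolutelyContinuous_of_le hκlam).ae_le hκ) (by simp only [mass]) hsum
  rw [mass] at h₁
  refine (eWp_triangle hp _ (L ∘ₘ (K ∘ₘ lam)) _).trans ?_
  gcongr
  refine (eWp_le_planCost (IsCoupling.compProd _ L)).trans ?_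
  refine eLpNorm'_mono_measure _ ?_ (by linarith)
  have hadd : ν ⊗ₘ L = (K ∘ₘ lam) ⊗ₘ L + (K ∘ₘ β') ⊗ₘ L := by
    rw [← Measure.compProd_add_left, ← Measure.comp_add, hK]
  exact (Measure.le_add_right le_rfl).trans hadd.ge

lemma planCost_compProd_le_eWp {d : ℕ} {p : ℝ} (hp : 1 ≤ p) {Y : Set (Rd d)}
    (hY : Bornology.IsBounded Y) {lam β β' ν : Measure (Rd d)} [IsFiniteMeasure lam]
    [IsFiniteMeasure β] [IsFiniteMeasure β'] (κ : Kernel (Rd d) (Rd d)) [IsMarkovKernel κ]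
    (hκ : ∀ᵐ y ∂(κ ∘ₘ (lam + β)), y ∈ Y) (hκ' : ∀ᵐ y ∂(κ ∘ₘ (lam + β')), y ∈ Y)
    (hν : ∀ᵐ y ∂ν, y ∈ Y) {e w : ℝ} (he : 0 ≤ e) (hw : 0 ≤ w)
    (hW : eWp p (lam + β) ν = ENNReal.ofReal w)
    (hcost : planCost p ((lam + β) ⊗ₘ κ) ≤ ENNReal.ofReal w + ENNReal.ofReal e)
    (hpush : eWp p (κ ∘ₘ (lam + β)) ν ≤ ENNReal.ofReal e) :
    planCost p ((lam + β') ⊗ₘ κ) ≤ eWp p (lam + β') ν +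
      (ENNReal.ofReal (12 * e + 4 * (e ^ (1 / p) * w ^ ((p - 1) / p))) +
        (ENNReal.ofReal e + ENNReal.ofReal (Metric.diam Y) * β univ ^ (1 / p)) +
        ENNReal.ofReal (Metric.diam Y) * β' univ ^ (1 / p)) := by
  set R := ENNReal.ofReal (12 * e + 4 * (e ^ (1 / p) * w ^ ((p - 1) / p)))
  have hWv : eWp p (lam + β) (κ ∘ₘ (lam + β)) ≤ ENNReal.ofReal w + ENNReal.ofReal e :=
    (eWp_le_planCost (IsCoupling.compProd _ κ)).trans hcost
  have hvW : ENNReal.ofReal w ≤ eWp p (lam + β) (κ ∘ₘ (lam + β)) + ENNReal.ofReal e := by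
    rw [← hW]
    refine (eWp_triangle hp _ (κ ∘ₘ (lam + β)) _).trans ?_
    gcongr
  have hlam : planCost p (lam ⊗ₘ κ) ≤ eWp p lam (κ ∘ₘ lam) + R := by
    conv_rhs => rw [eWp, ENNReal.iInf_add]
    refine le_iInf fun ⟨π, hπ⟩ => ?_
    refine ennreal_le_add_of_rpow_add_le hp (b := planCost p (β ⊗ₘ κ) ^ p)
      (v := eWp p (lam + β) (κ ∘ₘ (lam + β))) hw he ?_ ?_ hWv
    · rw [← planCost_rpow_add hp, ← Measure.compProd_add_left]
      gcongr
      refine hcost.trans ?_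
      rw [two_mul, ← add_assoc]
      gcongr
    · rw [← planCost_rpow_add hp]
      gcongr
      refine eWp_le_planCost ?_
      rw [Measure.comp_add]
      exact hπ.add (IsCoupling.compProd β κ)
  conv_rhs => rw [eWp, ENNReal.iInf_add]
  refine le_iInf fun ⟨π, hπ⟩ => ?_
  obtain ⟨K, hK, rfl, hKν⟩ := hπ.exists_kernel
  have hβ' : ∀ M : Kernel (Rd d) (Rd d), (∀ᵐ y ∂(M ∘ₘ (lam + β')), y ∈ Y) →
      ∀ᵐ y ∂(M ∘ₘ β'), y ∈ Y := fun M hM => by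
    rw [Measure.comp_add] at hM
    exact (Measure.absolutelyContinuous_of_le (Measure.le_add_left le_rfl)).ae_le hM
  have h₁ : planCost p (lam ⊗ₘ κ) ≤ planCost p (lam ⊗ₘ K) +
      (R + (ENNReal.ofReal e + ENNReal.ofReal (Metric.diam Y) * β univ ^ (1 / p))) := by
    calc planCost p (lam ⊗ₘ κ)
        ≤ eWp p lam (κ ∘ₘ lam) + R := hlam
      _ ≤ (eWp p lam (K ∘ₘ lam) + eWp p (K ∘ₘ lam) (κ ∘ₘ lam)) + R := by
        gcongr; exact eWp_triangle hp _ _ _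
      _ ≤ (planCost p (lam ⊗ₘ K) +
          (ENNReal.ofReal e + ENNReal.ofReal (Metric.diam Y) * β univ ^ (1 / p))) + R := by
        gcongr
        · exact eWp_le_planCost (IsCoupling.compProd lam K)
        · refine (eWp_comp_common_part_le hp hY κ K hKν hκ).trans ?_
          gcongr
          exact (eWp_le_swap p _ _).trans hpush
      _ = _ := by ring
  exact rpow_add_rpow_le_of_le_add hp
    (by rw [Measure.compProd_add_left, planCost_rpow_add hp])
    (by simp only [Measure.compProd_add_left, planCost_rpow_add hp]) h₁
    (planCost_compProd_le hp hY β' κ K (hβ' κ hκ') (hβ' K (hKν ▸ hν)))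

lemma enorm_rpow_eq_ofReal {d : ℕ} {p : ℝ} (hp : 1 ≤ p) (x : Rd d) :
    ‖x‖ₑ ^ p = ENNReal.ofReal (‖x‖ ^ p) := by
  rw [← ofReal_norm, ENNReal.ofReal_rpow_of_nonneg (norm_nonneg _) (by linarith)]

lemma toReal_planCost {d : ℕ} {p : ℝ} (hp : 1 ≤ p) (π : Measure (Rd d × Rd d)) :
    (planCost p π).toReal = (∫ z, ‖z.1 - z.2‖ ^ p ∂π) ^ (1 / p) := by
  rw [planCost, eLpNorm', ← ENNReal.toReal_rpow, integral_eq_lintegral_of_nonneg_ae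
    (Filter.Eventually.of_forall fun z => by positivity)
    (by fun_prop (disch := linarith))]
  simp only [enorm_rpow_eq_ofReal hp]

lemma Wp_eq_toReal {d : ℕ} {p : ℝ} (hp : 1 ≤ p) {μ ν : Measure (Rd d)}
    (h : ∀ π, IsCoupling π μ ν → planCost p π ≠ ⊤) : Wp p μ ν = (eWp p μ ν).toReal := by
  have e : (eWp p μ ν).toReal =
      ⨅ π : {π : Measure (Rd d × Rd d) // IsCoupling π μ ν}, (planCost p π.1).toReal :=
    ENNReal.toReal_iInf fun π => h π.1 π.2
  rw [e, Wp, iInf]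
  congr 1
  ext c
  simp only [mem_ofPred_eq, mem_range, Subtype.exists, toReal_planCost hp]
  constructor
  · rintro ⟨π, hπ, rfl⟩; exact ⟨π, hπ, rfl⟩
  · rintro ⟨π, hπ, rfl⟩; exact ⟨π, hπ, rfl⟩

lemma HasFiniteMoment.eLpNorm'_ne_top {d : ℕ} {p : ℝ} (hp : 1 ≤ p) {μ : Measure (Rd d)}
    (h : HasFiniteMoment p μ) : eLpNorm' (fun x => x) p μ ≠ ⊤ := by
  refine ENNReal.rpow_ne_top_of_nonneg (by positivity) ?_
  simp only [enorm_rpow_eq_ofReal hp]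
  exact (Integrable.lintegral_lt_top h).ne

lemma hasFiniteMoment_of_ae_mem {d : ℕ} {p : ℝ} (hp : 1 ≤ p) {μ : Measure (Rd d)}
    [IsFiniteMeasure μ] {Y : Set (Rd d)} (hY : Bornology.IsBounded Y) (h : ∀ᵐ y ∂μ, y ∈ Y) :
    HasFiniteMoment p μ := by
  obtain ⟨R, hR⟩ := hY.exists_norm_le
  refine Integrable.of_bound (by fun_prop (disch := linarith)) (R ^ p) ?_
  filter_upwards [h] with y hy
  rw [Real.norm_of_nonneg (by positivity)]
  exact Real.rpow_le_rpow (norm_nonneg _) (hR y hy) (by linarith)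

lemma IsCoupling.planCost_ne_top {d : ℕ} {p : ℝ} (hp : 1 ≤ p) {μ ν : Measure (Rd d)}
    {π : Measure (Rd d × Rd d)} (h : IsCoupling π μ ν) (hμ : HasFiniteMoment p μ)
    (hν : HasFiniteMoment p ν) : planCost p π ≠ ⊤ := by
  have h₁ := hμ.eLpNorm'_ne_top hp
  have h₂ := hν.eLpNorm'_ne_top hp
  have e₁ : eLpNorm' (fun z : Rd d × Rd d => z.1 - 0) p π = eLpNorm' (fun x => x) p μ := by
    simp only [eLpNorm', sub_zero]
    rw [← h.1, lintegral_map (by fun_prop) (by fun_prop)]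
  have e₂ : eLpNorm' (fun z : Rd d × Rd d => 0 - z.2) p π = eLpNorm' (fun x => x) p ν := by
    simp only [eLpNorm', zero_sub, enorm_neg]
    rw [← h.2, lintegral_map (by fun_prop) (by fun_prop)]
  refine ne_top_of_le_ne_top ?_ (eLpNorm'_sub_le_add (g := fun _ => 0) hp measurable_fst
    measurable_const measurable_snd)
  rw [e₁, e₂]
  finiteness

lemma kernelCost_eq_toReal {d : ℕ} {p : ℝ} (hp : 1 ≤ p) {μ : Measure (Rd d)}
    [IsFiniteMeasure μ] (κ : Kernel (Rd d) (Rd d)) [IsMarkovKernel κ]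
    (h : planCost p (μ ⊗ₘ κ) ≠ ⊤) : kernelCost p κ μ = (planCost p (μ ⊗ₘ κ)).toReal := by
  have hp0 : 0 < p := by linarith
  have hint : Integrable (fun z : Rd d × Rd d => ‖z.1 - z.2‖ ^ p) (μ ⊗ₘ κ) := by
    refine ⟨by fun_prop (disch := linarith), ?_⟩
    rw [hasFiniteIntegral_iff_ofReal (Filter.Eventually.of_forall fun z => by positivity)]
    simp only [← enorm_rpow_eq_ofReal hp]
    rw [lt_top_iff_ne_top]
    intro htop
    apply h
    rw [planCost, eLpNorm', htop, ENNReal.top_rpow_of_pos (by positivity)]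
  rw [toReal_planCost hp, kernelCost, Measure.integral_compProd hint]

lemma tvDist_nonneg {α : Type*} [MeasurableSpace α] (μ ν : Measure α) : 0 ≤ tvDist μ ν :=
  Real.sSup_nonneg fun _ ⟨_, _, hr⟩ => hr ▸ abs_nonneg _

lemma le_tvDist {α : Type*} [MeasurableSpace α] (μ ν : Measure α) [IsProbabilityMeasure μ]
    [IsProbabilityMeasure ν] {s : Set α} (hs : MeasurableSet s) :
    μ.real s - ν.real s ≤ tvDist μ ν := by
  refine (le_abs_self _).trans (le_csSup ⟨1, ?_⟩ ⟨s, hs, rfl⟩)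
  rintro r ⟨A, -, rfl⟩
  have h₁ : μ.real A ≤ 1 := measureReal_le_one
  have h₂ : ν.real A ≤ 1 := measureReal_le_one
  have h₃ : 0 ≤ μ.real A := measureReal_nonneg
  have h₄ : 0 ≤ ν.real A := measureReal_nonneg
  change |μ.real A - ν.real A| ≤ 1
  rw [abs_le]
  constructor <;> linarith

lemma exists_common_part_tvDist {α : Type*} [MeasurableSpace α] (μ μ' : Measure α)
    [IsProbabilityMeasure μ] [IsProbabilityMeasure μ'] :
    ∃ m a b : Measure α, IsFiniteMeasure m ∧ IsFiniteMeasure a ∧ IsFiniteMeasure b ∧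
      μ = m + a ∧ μ' = m + b ∧ a univ ≤ ENNReal.ofReal (tvDist μ μ') ∧
      b univ ≤ ENNReal.ofReal (tvDist μ μ') := by
  obtain ⟨m, a, b, s, hs, hμ, hμ', ha⟩ := exists_common_part μ μ'
  have hm : IsFiniteMeasure m :=
    isFiniteMeasure_of_le μ (hμ ▸ Measure.le_add_right le_rfl)
  have haf : IsFiniteMeasure a :=
    isFiniteMeasure_of_le μ (hμ ▸ Measure.le_add_left le_rfl)
  have hbf : IsFiniteMeasure b :=
    isFiniteMeasure_of_le μ' (hμ' ▸ Measure.le_add_left le_rfl)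
  have hab : a univ = b univ := by
    have h₁ : m univ + a univ = m univ + b univ := by
      rw [← Measure.add_apply, ← Measure.add_apply, ← hμ, ← hμ', measure_univ, measure_univ]
    rwa [ENNReal.add_right_inj (measure_ne_top m univ)] at h₁
  have hle : a univ ≤ ENNReal.ofReal (tvDist μ μ') := by
    rw [ENNReal.le_ofReal_iff_toReal_le (measure_ne_top _ _) (tvDist_nonneg _ _)]
    have h₁ := congrArg ENNReal.toReal ha
    rw [ENNReal.toReal_add (measure_ne_top _ _) (measure_ne_top _ _)] at h₁
    have h₂ : μ.real s - μ'.real s ≤ tvDist μ μ' := le_tvDist μ μ' hs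
    simp only [Measure.real] at h₂
    linarith
  exact ⟨m, a, b, hm, haf, hbf, hμ, hμ', hle, hab ▸ hle⟩

lemma Ep_le {d : ℕ} {p : ℝ} (hp : 1 ≤ p) {Y : Set (Rd d)} (hY : Bornology.IsBounded Y)
    (μ μ' ν : Measure (Rd d)) [IsProbabilityMeasure μ] [IsProbabilityMeasure μ']
    [IsProbabilityMeasure ν] (κ : Kernel (Rd d) (Rd d)) [IsMarkovKernel κ]
    (hμ : HasFiniteMoment p μ) (hμ' : HasFiniteMoment p μ') (hν : ∀ᵐ y ∂ν, y ∈ Y)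
    (hκ : ∀ᵐ y ∂(κ ∘ₘ μ), y ∈ Y) (hκ' : ∀ᵐ y ∂(κ ∘ₘ μ'), y ∈ Y) :
    Ep p κ μ' ν ≤ 14 * (Ep p κ μ ν + Ep p κ μ ν ^ (1 / p) * Wp p μ ν ^ ((p - 1) / p) +
      Metric.diam Y * tvDist μ μ' ^ (1 / p)) := by
  have hp0 : 0 < p := by linarith
  have mν := hasFiniteMoment_of_ae_mem hp hY hν
  have mκ := hasFiniteMoment_of_ae_mem hp hY hκ
  have mκ' := hasFiniteMoment_of_ae_mem hp hY hκ'
  have top {ρ₁ ρ₂ : Measure (Rd d)} [IsProbabilityMeasure ρ₁] [IsProbabilityMeasure ρ₂]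
      (h₁ : HasFiniteMoment p ρ₁) (h₂ : HasFiniteMoment p ρ₂) :
      Wp p ρ₁ ρ₂ = (eWp p ρ₁ ρ₂).toReal ∧ eWp p ρ₁ ρ₂ ≠ ⊤ := by
    have hc : ∀ π, IsCoupling π ρ₁ ρ₂ → planCost p π ≠ ⊤ :=
      fun π h => h.planCost_ne_top hp h₁ h₂
    have hprod : IsCoupling (ρ₁.prod ρ₂) ρ₁ ρ₂ := by
      constructor <;> simp
    exact ⟨Wp_eq_toReal hp hc, ne_top_of_le_ne_top (hc _ hprod) (eWp_le_planCost hprod)⟩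
  obtain ⟨W₁, T₁⟩ := top hμ mν
  obtain ⟨W₂, T₂⟩ := top hμ' mν
  obtain ⟨W₃, T₃⟩ := top mκ mν
  obtain ⟨W₄, T₄⟩ := top mκ' mν
  have C₁ := (IsCoupling.compProd μ κ).planCost_ne_top hp hμ mκ
  have C₂ := (IsCoupling.compProd μ' κ).planCost_ne_top hp hμ' mκ'
  have K₁ := kernelCost_eq_toReal hp κ C₁
  have K₂ := kernelCost_eq_toReal hp κ C₂
  set D := Metric.diam Y
  have hD0 : 0 ≤ D := Metric.diam_nonneg
  set ε := tvDist μ μ'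
  have hε0 : 0 ≤ ε := tvDist_nonneg _ _
  set w := Wp p μ ν
  have hw0 : 0 ≤ w := by rw [W₁]; exact ENNReal.toReal_nonneg
  have hEdef : Ep p κ μ ν = max (kernelCost p κ μ - w) 0 + Wp p (κ ∘ₘ μ) ν := rfl
  have hEdef' : Ep p κ μ' ν =
    max (kernelCost p κ μ' - Wp p μ' ν) 0 + Wp p (κ ∘ₘ μ') ν := rfl
  have hW30 : 0 ≤ Wp p (κ ∘ₘ μ) ν := by rw [W₃]; exact ENNReal.toReal_nonneg
  have hmax := le_max_left (kernelCost p κ μ - w) 0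
  have hmax0 := le_max_right (kernelCost p κ μ - w) 0
  set e := Ep p κ μ ν
  have he0 : 0 ≤ e := by linarith
  have hWw : eWp p μ ν = ENNReal.ofReal w := by rw [W₁, ENNReal.ofReal_toReal T₁]
  have hcost : planCost p (μ ⊗ₘ κ) ≤ ENNReal.ofReal w + ENNReal.ofReal e := by
    rw [← ENNReal.ofReal_add hw0 he0, ← ENNReal.ofReal_toReal C₁, ← K₁]
    exact ENNReal.ofReal_le_ofReal (by linarith)
  have hpush : eWp p (κ ∘ₘ μ) ν ≤ ENNReal.ofReal e := by
    rw [← ENNReal.ofReal_toReal T₃, ← W₃]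
    exact ENNReal.ofReal_le_ofReal (by linarith)
  set δ := D * ε ^ (1 / p) with hδ
  have hδ0 : 0 ≤ δ := by positivity
  have hδle {z : ℝ≥0∞} (hz : z ≤ ENNReal.ofReal ε) :
      ENNReal.ofReal D * z ^ (1 / p) ≤ ENNReal.ofReal δ := by
    rw [hδ, ENNReal.ofReal_mul hD0, ← ENNReal.ofReal_rpow_of_nonneg hε0 (by positivity)]
    gcongr
  set ew := e ^ (1 / p) * w ^ ((p - 1) / p)
  have hew0 : 0 ≤ ew := by positivity
  obtain ⟨m, a, b, hm, ha, hb, hma, hmb, hale, hble⟩ := exists_common_part_tvDist μ μ'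
  have gap : kernelCost p κ μ' ≤ Wp p μ' ν + (12 * e + 4 * ew + (e + δ) + δ) := by
    have h : planCost p (μ' ⊗ₘ κ) ≤ eWp p μ' ν + (ENNReal.ofReal (12 * e + 4 * ew) +
        (ENNReal.ofReal e + ENNReal.ofReal δ) + ENNReal.ofReal δ) := by
      have := planCost_compProd_le_eWp (lam := m) (β := a) (β' := b) hp hY κ (hma ▸ hκ)
        (hmb ▸ hκ') hν he0 hw0 (hma ▸ hWw) (hma ▸ hcost) (hma ▸ hpush)
      rw [← hmb] at this
      refine this.trans ?_
      gcongr
      · exact hδle hale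
      · exact hδle hble
    rw [← ENNReal.ofReal_add he0 hδ0, ← ENNReal.ofReal_add (by positivity) (by positivity),
      ← ENNReal.ofReal_add (by positivity) hδ0] at h
    rw [K₂, W₂, ← ENNReal.toReal_ofReal (r := 12 * e + 4 * ew + (e + δ) + δ) (by positivity),
      ← ENNReal.toReal_add T₂ ENNReal.ofReal_ne_top]
    exact ENNReal.toReal_mono (by finiteness) h
  have feas : Wp p (κ ∘ₘ μ') ν ≤ δ + e := by
    have h : eWp p (κ ∘ₘ μ') ν ≤ ENNReal.ofReal δ + ENNReal.ofReal e := by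
      refine (eWp_triangle hp _ (κ ∘ₘ μ) _).trans ?_
      gcongr
      have hmass : (κ ∘ₘ b) univ = b univ := by
        rw [Measure.bind_apply MeasurableSet.univ κ.aemeasurable]; simp
      have hsum : κ ∘ₘ μ' + κ ∘ₘ a = κ ∘ₘ μ + κ ∘ₘ b := by
        simp only [← Measure.comp_add]
        rw [hma, hmb, add_right_comm]
      refine (eWp_le_of_add_eq_add hp hY hκ' hκ (by simp) hsum).trans ?_
      rw [hmass]
      exact hδle hble
    rw [W₄]
    rw [← ENNReal.ofReal_add hδ0 he0] at h
    exact ENNReal.toReal_le_of_le_ofReal (by positivity) h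
  have hgap : max (kernelCost p κ μ' - Wp p μ' ν) 0 ≤ 12 * e + 4 * ew + (e + δ) + δ :=
    max_le (by linarith) (by positivity)
  rw [hEdef']
  linarith

/-- TV stability of `E_p` in the source measure: there is an absolute
constant `C` such that, with `ε = ‖μ − μ'‖_TV`,
`E_p(κ;μ',ν) ≤ C (E_p(κ;μ,ν) + E_p(κ;μ,ν)^{1/p} W_p(μ,ν)^{(p−1)/p} + diam(Y) ε^{1/p})`;
in particular, for `p = 1`, `E_1(κ;μ',ν) ≤ C (E_1(κ;μ,ν) + diam(Y) ε)`. -/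
theorem ep_tv_stability :
    ∃ C : ℝ, 0 < C ∧
      ∀ {d : ℕ}, 1 ≤ d → ∀ {p : ℝ}, 1 ≤ p →
      ∀ (X Y : Set (Rd d)), MeasurableSet X → MeasurableSet Y → Bornology.IsBounded Y →
      ∀ (μ μ' ν : Measure (Rd d)), IsProbabilityMeasure μ → IsProbabilityMeasure μ' →
        IsProbabilityMeasure ν →
        μ X = 1 → μ' X = 1 → ν Y = 1 →
        HasFiniteMoment p μ → HasFiniteMoment p μ' → HasFiniteMoment p ν →
      ∀ (κ : Kernel (Rd d) (Rd d)), IsMarkovKernel κ → (∀ x ∈ X, κ x Y = 1) →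
        (Ep p κ μ' ν ≤ C * (Ep p κ μ ν +
            Ep p κ μ ν ^ (1 / p) * Wp p μ ν ^ ((p - 1) / p) +
            Metric.diam Y * tvDist μ μ' ^ (1 / p))) ∧
        (p = 1 → Ep p κ μ' ν ≤ C * (Ep p κ μ ν + Metric.diam Y * tvDist μ μ')) := by
  refine ⟨28, by norm_num, ?_⟩
  intro d _ p hp X Y hX hY hYb μ μ' ν _ _ _ hμX hμ'X hνY hμ hμ' _ κ _ hκ
  have hν : ∀ᵐ y ∂ν, y ∈ Y := (prob_compl_eq_zero_iff hY).2 hνY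
  have push (ρ : Measure (Rd d)) [IsProbabilityMeasure ρ] (hρ : ρ X = 1) :
      ∀ᵐ y ∂(κ ∘ₘ ρ), y ∈ Y := by
    refine Measure.ae_comp_of_ae_ae hY ?_
    have hX' : ∀ᵐ x ∂ρ, x ∈ X := (prob_compl_eq_zero_iff hX).2 hρ
    filter_upwards [hX'] with x hx
    exact (prob_compl_eq_zero_iff hY).2 (hκ x hx)
  have main := Ep_le hp hYb μ μ' ν κ hμ hμ' hν (push μ hμX) (push μ' hμ'X)
  have hW (ρ₁ ρ₂ : Measure (Rd d)) : 0 ≤ Wp p ρ₁ ρ₂ :=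
    Real.sInf_nonneg fun c ⟨π, _, hc⟩ => hc ▸ by positivity
  have hE : 0 ≤ Ep p κ μ ν := add_nonneg (le_max_right _ _) (hW _ _)
  have hε := tvDist_nonneg μ μ'
  have hD : 0 ≤ Metric.diam Y := Metric.diam_nonneg
  refine ⟨main.trans ?_, ?_⟩
  · have := hW μ ν
    gcongr
    norm_num
  · rintro rfl
    simp only [div_one, Real.rpow_one, sub_self, Real.rpow_zero, mul_one] at main
    nlinarith [mul_nonneg hD hε]
end
end
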